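/- Let β ≥ −1 be an integer or half-integer, n ∈ ℕ and k ∈ {1,…,n}. If 2β + n is even, then 𝐉_{n,k}(β) is a rational number. -/

import Mathlib

open MeasureTheory Real

noncomputable section

/-- The uniform probability measure on the unit sphere of `ℝ^m`. -/
def sphereUnif (m : ℕ) : Measure (Metric.sphere (0 : EuclideanSpace ℝ (Fin m)) 1) :=
  ((volume : Measure (EuclideanSpace ℝ (Fin m))).toSphere Set.univ)⁻¹ •
    (volume : Measure (EuclideanSpace ℝ (Fin m))).toSphere

/-- The internal angle of a set `P ⊆ ℝ^m` at a reference point `g₀` (a point in the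
relative interior of the face of interest): the normalized spherical Lebesgue measure of
the set of directions `u` on the unit sphere with `g₀ + ε • u ∈ P` for some `ε > 0`. -/
def internalAngle {m : ℕ} (g₀ : EuclideanSpace ℝ (Fin m))
    (P : Set (EuclideanSpace ℝ (Fin m))) : ℝ :=
  (sphereUnif m {u : Metric.sphere (0 : EuclideanSpace ℝ (Fin m)) 1 |
    ∃ ε : ℝ, 0 < ε ∧ g₀ + ε • (u : EuclideanSpace ℝ (Fin m)) ∈ P}).toReal

/-- The beta density `f_{d,β}` on `ℝ^d`. -/
def betaDensity (d : ℕ) (β : ℝ) (x : EuclideanSpace ℝ (Fin d)) : ℝ :=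
  (Real.Gamma ((d : ℝ) / 2 + β + 1) / (Real.pi ^ ((d : ℝ) / 2) * Real.Gamma (β + 1))) *
    (if ‖x‖ < 1 then (1 - ‖x‖ ^ 2) ^ β else 0)

/-- The beta distribution on `ℝ^d` with parameter `β > -1`; for `β = -1` it is
interpreted as the uniform distribution on the unit sphere `S^{d-1}`. -/
def betaMeasure (d : ℕ) (β : ℝ) : Measure (EuclideanSpace ℝ (Fin d)) :=
  if β = -1 then
    Measure.map
      (fun u : Metric.sphere (0 : EuclideanSpace ℝ (Fin d)) 1 => (u : EuclideanSpace ℝ (Fin d)))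
      (sphereUnif d)
  else
    volume.withDensity fun x => ENNReal.ofReal (betaDensity d β x)

/-- `J n k β`: the expected internal angle of the beta simplex `[X_1,…,X_n]` at its face
`[X_1,…,X_k]`, where `X_1,…,X_n` are i.i.d. points in `ℝ^(n-1)` with beta density
`f_{n-1,β}`. The reference point in the relative interior of the face is its centroid. -/
def J (n k : ℕ) (β : ℝ) : ℝ :=
  ∫ X : Fin n → EuclideanSpace ℝ (Fin (n - 1)),
    internalAngle
      ((k : ℝ)⁻¹ • ∑ i ∈ Finset.univ.filter (fun i : Fin n => (i : ℕ) < k), X i)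
      (convexHull ℝ (Set.range X))
    ∂(Measure.pi fun _ : Fin n => betaMeasure (n - 1) β)

/-- `Jb n k β = binom(n,k) * J n k β`, the expected internal angle sum `𝐉_{n,k}(β)`. -/
def Jb (n k : ℕ) (β : ℝ) : ℝ := (n.choose k : ℝ) * J n k β

section Projection

variable {E : Type*} [NormedAddCommGroup E] [InnerProductSpace ℝ E]

open Classical in
/-- The coefficients, with respect to `δ`, of the orthogonal projection of `x` to the span of
`δ` (for linearly independent `δ`). -/
def projCoef {ι : Type*} [Fintype ι] (δ : ι → E) (x : E) : ι → ℝ :=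
  (Matrix.gram ℝ δ)⁻¹.mulVec fun i => inner ℝ (δ i) x

/-- The component of `x` orthogonal to the span of `δ`. -/
def projRes {ι : Type*} [Fintype ι] (δ : ι → E) (x : E) : E :=
  x - ∑ i, projCoef δ x i • δ i

theorem eq_projCoef_iff {ι : Type*} [Fintype ι] {δ : ι → E} (hδ : LinearIndependent ℝ δ)
    (x : E) (a : ι → ℝ) :
    a = projCoef δ x ↔ ∀ j, inner ℝ (x - ∑ i, a i • δ i) (δ j) = 0 := by
  classical
  have hdet : IsUnit (Matrix.gram ℝ δ).det :=
    isUnit_iff_ne_zero.2 (Matrix.det_gram_ne_zero_iff_linearIndependent.2 hδ)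
  have h1 : (∀ j, inner ℝ (x - ∑ i, a i • δ i) (δ j) = 0) ↔
      (Matrix.gram ℝ δ).mulVec a = fun i => inner ℝ (δ i) x := by
    rw [funext_iff]
    refine forall_congr' fun j => ?_
    rw [inner_sub_left, sub_eq_zero, real_inner_comm, sum_inner, eq_comm]
    have : ∀ i, inner ℝ (a i • δ i) (δ j) = Matrix.gram ℝ δ j i * a i := by
      intro i
      rw [real_inner_smul_left, Matrix.gram_apply, real_inner_comm, mul_comm]
    simp only [this]
    rfl
  rw [h1]
  have h2 : projCoef δ x = (Matrix.gram ℝ δ)⁻¹.mulVec fun i => inner ℝ (δ i) x := by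
    unfold projCoef
    congr!
  rw [h2]
  constructor
  · rintro rfl
    rw [Matrix.mulVec_mulVec, Matrix.mul_nonsing_inv _ hdet, Matrix.one_mulVec]
  · intro h
    rw [← h, Matrix.mulVec_mulVec, Matrix.nonsing_inv_mul _ hdet, Matrix.one_mulVec]

theorem inner_projRes_eq_zero {ι : Type*} [Fintype ι] {δ : ι → E} (hδ : LinearIndependent ℝ δ)
    (x : E) (j : ι) : inner ℝ (projRes δ x) (δ j) = 0 :=
  (eq_projCoef_iff hδ x _).1 rfl j

theorem projCoef_smul {ι : Type*} [Fintype ι] (δ : ι → E) (x : E) {c : ℝ} (hc : c ≠ 0) :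
    projCoef (c • δ) x = c⁻¹ • projCoef δ x := by
  classical
  have hg : Matrix.gram ℝ (c • δ) = (c ^ 2) • Matrix.gram ℝ δ := by
    ext i j
    simp [real_inner_smul_left, real_inner_smul_right]
    ring
  have hinv : ((c ^ 2) • Matrix.gram ℝ δ)⁻¹ = (c ^ 2)⁻¹ • (Matrix.gram ℝ δ)⁻¹ := by
    by_cases h : IsUnit (Matrix.gram ℝ δ).det
    · have := Matrix.inv_smul' (Matrix.gram ℝ δ) (Units.mk0 (c ^ 2) (pow_ne_zero 2 hc)) h
      simpa [Units.smul_def] using this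
    · rw [Matrix.nonsing_inv_apply_not_isUnit _ h, Matrix.nonsing_inv_apply_not_isUnit, smul_zero]
      rw [Matrix.det_smul, isUnit_iff_ne_zero]
      rw [isUnit_iff_ne_zero, not_not] at h
      simp [h]
  have h2 : ∀ δ : ι → E, projCoef δ x =
      (Matrix.gram ℝ δ)⁻¹.mulVec fun i => inner ℝ (δ i) x := by
    intro δ
    unfold projCoef
    congr!
  rw [h2, h2, hg, hinv]
  have : (fun i => inner ℝ ((c • δ) i) x) = c • fun i => inner ℝ (δ i) x := by
    ext i
    simp [real_inner_smul_left]
  rw [this, Matrix.smul_mulVec, Matrix.mulVec_smul, smul_smul]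
  congr 1
  field_simp

theorem projRes_smul {ι : Type*} [Fintype ι] (δ : ι → E) (x : E) {c : ℝ} (hc : c ≠ 0) :
    projRes (c • δ) x = projRes δ x := by
  unfold projRes
  rw [projCoef_smul δ x hc]
  congr 1
  refine Finset.sum_congr rfl fun i _ => ?_
  simp [smul_smul, hc, mul_comm]

/-- The optimality conditions for the coefficients `a` of the point nearest to `x` in the cone
of all `∑ a i • δ i` with `a i ≥ 0` for `i ∈ P`. -/
def IsOptimal {τ : Type*} [Fintype τ] (δ : τ → E) (x : E) (P : Finset τ) (a : τ → ℝ) : Prop :=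
  (∀ i ∈ P, 0 ≤ a i ∧ inner ℝ (x - ∑ i, a i • δ i) (δ i) ≤ 0 ∧
    (0 < a i → inner ℝ (x - ∑ i, a i • δ i) (δ i) = 0)) ∧
  ∀ i ∉ P, inner ℝ (x - ∑ i, a i • δ i) (δ i) = 0

theorem exists_isOptimal {τ : Type*} [Fintype τ] {δ : τ → E}
    (hδ : LinearIndependent ℝ δ) (x : E) (P : Finset τ) : ∃ a, IsOptimal δ x P a := by
  classical
  let T : (τ → ℝ) →ₗ[ℝ] E := Fintype.linearCombination ℝ δ
  have hT : ∀ a, T a = ∑ i, a i • δ i := fun a => Fintype.linearCombination_apply ℝ δ a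
  have hinj : Function.Injective T :=
    linearIndependent_iff_injective_fintypeLinearCombination.1 hδ
  have hemb : Topology.IsClosedEmbedding T := T.isClosedEmbedding_of_injective
    (LinearMap.ker_eq_bot.2 hinj)
  let S : Set (τ → ℝ) := {a | ∀ i ∈ P, 0 ≤ a i}
  have hSc : IsClosed S := by
    have : S = ⋂ i ∈ P, {a | 0 ≤ a i} := by ext; simp [S]
    rw [this]
    exact isClosed_biInter fun i _ => isClosed_le continuous_const (continuous_apply i)
  have hSv : Convex ℝ S := by
    intro a ha b hb s t hs ht _ i hi
    have h1 := ha i hi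
    have h2 := hb i hi
    simp only [Pi.add_apply, Pi.smul_apply, smul_eq_mul]
    positivity
  have hcompl : IsComplete (T '' S) := by
    have h1 : IsComplete S := hSc.isComplete
    have hu : IsUniformInducing T := by
      obtain ⟨K, _, hK⟩ := T.exists_antilipschitzWith (LinearMap.ker_eq_bot.2 hinj)
      exact hK.isUniformInducing (LinearMap.toContinuousLinearMap T).uniformContinuous
    exact hu.isComplete_iff.2 h1
  obtain ⟨v, ⟨a, ha, rfl⟩, hv⟩ := exists_norm_eq_iInf_of_complete_convex
    (⟨T 0, 0, by simp [S], rfl⟩ : (T '' S).Nonempty) hcompl (hSv.linear_image T) x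
  have hle := (norm_eq_iInf_iff_real_inner_le_zero (hSv.linear_image T)
    (Set.mem_image_of_mem T ha)).1 hv
  have key : ∀ (i : τ) (t : ℝ), (i ∈ P → 0 ≤ a i + t) → t * inner ℝ (x - T a) (δ i) ≤ 0 := by
    intro i t hit
    have hmem : T (a + Pi.single i t) ∈ T '' S := by
      refine Set.mem_image_of_mem T fun j hj => ?_
      by_cases hji : j = i
      · subst hji
        simpa using hit hj
      · simpa [hji] using ha j hj
    have := hle _ hmem
    rw [map_add, add_sub_cancel_left] at this
    have hs : T (Pi.single i t) = t • δ i := by simp [T]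
    rwa [hs, real_inner_smul_right] at this
  refine ⟨a, fun i hi => ⟨ha i hi, ?_, fun hpos => ?_⟩, fun i hi => ?_⟩
  all_goals rw [← hT]
  · simpa using key i 1 fun _ => by linarith [ha i hi]
  · have h1 := key i 1 fun _ => by linarith
    have h2 := key i (-a i) fun _ => by simp
    nlinarith
  · have h1 := key i 1 fun h => absurd h hi
    have h2 := key i (-1) fun h => absurd h hi
    linarith

theorem IsOptimal.unique {τ : Type*} [Fintype τ] {δ : τ → E}
    (hδ : LinearIndependent ℝ δ) {x : E} {P : Finset τ} {a b : τ → ℝ}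
    (ha : IsOptimal δ x P a) (hb : IsOptimal δ x P b) : a = b := by
  have half : ∀ a b : τ → ℝ, IsOptimal δ x P a → IsOptimal δ x P b →
      inner ℝ (x - ∑ i, a i • δ i) (∑ i, b i • δ i - ∑ i, a i • δ i) ≤ 0 := by
    intro a b ha hb
    rw [← Finset.sum_sub_distrib, inner_sum]
    refine Finset.sum_nonpos fun i _ => ?_
    rw [← sub_smul, real_inner_smul_right]
    by_cases hi : i ∈ P
    · obtain ⟨h1, h2, h3⟩ := ha.1 i hi
      have h4 := (hb.1 i hi).1
      rcases h1.eq_or_lt with h | h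
      · rw [← h]; nlinarith
      · rw [h3 h]; simp
    · rw [ha.2 i hi]; simp
  have h1 := half a b ha hb
  have h2 := half b a hb ha
  set p := ∑ i, a i • δ i
  set p' := ∑ i, b i • δ i
  have h3 : inner ℝ (p' - p) (p' - p) ≤ 0 := by
    have e : p' - p = (x - p) - (x - p') := by abel
    have e2 : inner ℝ (p' - p) (p' - p) = inner ℝ (x - p) (p' - p) + inner ℝ (x - p') (p - p') := by
      nth_rewrite 1 [e]
      rw [inner_sub_left, sub_eq_add_neg, ← inner_neg_right, neg_sub]
    linarith
  have h4 : p' - p = 0 := real_inner_self_nonpos.1 h3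
  have h5 : p = p' := (sub_eq_zero.1 h4).symm
  exact linearIndependent_iff_injective_fintypeLinearCombination.1 hδ
    (by simpa [Fintype.linearCombination_apply] using h5)

/-- The nearest point of the cone lies in the relative interior of the face spanned by the
`δ i` with `i ∉ P` or `i ∈ A`. -/
def FaceEvent {τ : Type*} [Fintype τ] [DecidableEq τ] (P A : Finset τ) (δ : τ → E) (x : E) : Prop :=
  (∀ i : {i // i ∉ P ∨ i ∈ A}, i.1 ∈ A →
    0 < projCoef (fun i : {i // i ∉ P ∨ i ∈ A} => δ i.1) x i) ∧
  ∀ j : {j // ¬(j ∉ P ∨ j ∈ A)},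
    inner ℝ (projRes (fun i : {i // i ∉ P ∨ i ∈ A} => δ i.1) x) (δ j.1) ≤ 0

theorem faceEvent_iff {τ : Type*} [Fintype τ] [DecidableEq τ] {P A : Finset τ} (hA : A ⊆ P) {δ : τ → E}
    (hδ : LinearIndependent ℝ δ) (x : E) :
    FaceEvent P A δ x ↔ ∃ a, IsOptimal δ x P a ∧ ∀ i, i ∈ A ↔ i ∈ P ∧ 0 < a i := by
  classical
  set p : τ → Prop := fun i => i ∉ P ∨ i ∈ A with hp
  have hδ' : LinearIndependent ℝ (fun i : {i // p i} => δ i.1) :=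
    hδ.comp _ Subtype.val_injective
  have hsum : ∀ a : τ → ℝ, (∀ i, ¬ p i → a i = 0) →
      ∑ i, a i • δ i = ∑ i : {i // p i}, a i.1 • δ i.1 := by
    intro a ha
    rw [← Finset.sum_subtype (Finset.univ.filter p) (by simp) (fun i => a i • δ i),
      Finset.sum_filter_of_ne]
    intro i _ h
    by_contra hpi
    exact h (by rw [ha i hpi, zero_smul])
  constructor
  · rintro ⟨h1, h2⟩
    set c := projCoef (fun i : {i // p i} => δ i.1) x with hc
    let a : τ → ℝ := fun i => if h : p i then c ⟨i, h⟩ else 0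
    have ha0 : ∀ i, ¬ p i → a i = 0 := fun i hi => by simp [a, hi]
    have ha1 : ∀ i : {i // p i}, a i.1 = c i := fun i => by simp [a, i.2]
    have hr : x - ∑ i, a i • δ i = projRes (fun i : {i // p i} => δ i.1) x := by
      rw [hsum a ha0, projRes]
      simp only [ha1, hc]
    refine ⟨a, ⟨fun i hi => ?_, fun i hi => ?_⟩, fun i => ⟨fun hi => ⟨hA hi, ?_⟩, ?_⟩⟩
    · rw [hr]
      by_cases hpi : p i
      · have hiA : i ∈ A := hpi.resolve_left (by simpa using hi)
        have h3 := inner_projRes_eq_zero hδ' x ⟨i, hpi⟩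
        refine ⟨?_, h3.le, fun _ => h3⟩
        have := h1 ⟨i, hpi⟩ hiA
        rw [ha1 ⟨i, hpi⟩]
        exact this.le
      · rw [ha0 i hpi]
        exact ⟨le_rfl, h2 ⟨i, hpi⟩, fun h => absurd h (lt_irrefl _)⟩
    · rw [hr]
      exact inner_projRes_eq_zero hδ' x ⟨i, Or.inl hi⟩
    · have := h1 ⟨i, Or.inr hi⟩ hi
      rw [ha1 ⟨i, Or.inr hi⟩]
      exact this
    · rintro ⟨hiP, hpos⟩
      by_contra hiA
      have : ¬ p i := by simp [hp, hiP, hiA]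
      rw [ha0 i this] at hpos
      exact lt_irrefl _ hpos
  · rintro ⟨a, ha, hAa⟩
    have ha0 : ∀ i, ¬ p i → a i = 0 := by
      intro i hi
      simp only [hp, not_or, not_not] at hi
      have h1 := (ha.1 i hi.1).1
      have h2 : ¬ 0 < a i := fun h => hi.2 ((hAa i).2 ⟨hi.1, h⟩)
      linarith
    have hc : (fun i : {i // p i} => a i.1) = projCoef (fun i : {i // p i} => δ i.1) x := by
      rw [eq_projCoef_iff hδ']
      intro j
      rw [← hsum a ha0]
      rcases j.2 with h | h
      · exact ha.2 _ h
      · exact (ha.1 _ (hA h)).2.2 ((hAa _).1 h).2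
    have hr : x - ∑ i, a i • δ i = projRes (fun i : {i // p i} => δ i.1) x := by
      rw [hsum a ha0, projRes, ← hc]
    refine ⟨fun i hi => ?_, fun j => ?_⟩
    · change 0 < projCoef (fun i : {i // p i} => δ i.1) x i
      rw [← hc]
      exact ((hAa _).1 hi).2
    · change inner ℝ (projRes (fun i : {i // p i} => δ i.1) x) (δ j.1) ≤ 0
      rw [← hr]
      have hj := j.2
      simp only [not_or, not_not] at hj
      exact (ha.1 _ hj.1).2.1

theorem existsUnique_faceEvent {τ : Type*} [Fintype τ] [DecidableEq τ] (P : Finset τ) {δ : τ → E}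
    (hδ : LinearIndependent ℝ δ) (x : E) :
    ∃! A, A ∈ P.powerset ∧ FaceEvent P A δ x := by
  classical
  obtain ⟨a, ha⟩ := exists_isOptimal hδ x P
  refine ⟨P.filter fun i => 0 < a i, ⟨Finset.mem_powerset.2 (Finset.filter_subset _ _), ?_⟩, ?_⟩
  · exact (faceEvent_iff (Finset.filter_subset _ _) hδ x).2 ⟨a, ha, by simp⟩
  · rintro A ⟨hA, h⟩
    obtain ⟨b, hb, hAb⟩ := (faceEvent_iff (Finset.mem_powerset.1 hA) hδ x).1 h
    obtain rfl := ha.unique hδ hb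
    ext i
    simp [hAb i]

end Projection

section Measurability

variable {E : Type*} [NormedAddCommGroup E] [InnerProductSpace ℝ E] {ι : Type*} [Fintype ι]

theorem continuous_det_gram [DecidableEq ι] :
    Continuous fun δ : ι → E => (Matrix.gram ℝ δ).det := by
  refine Continuous.matrix_det ?_
  refine continuous_matrix fun i j => ?_
  simp only [Matrix.gram_apply]
  fun_prop

theorem projCoef_eq_inv_det [DecidableEq ι] (δ : ι → E) (x : E) (i : ι) : projCoef δ x i =
    ((Matrix.gram ℝ δ).det)⁻¹ *
      ((Matrix.gram ℝ δ).adjugate.mulVec fun i => inner ℝ (δ i) x) i := by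
  have h2 : projCoef δ x = (Matrix.gram ℝ δ)⁻¹.mulVec fun i => inner ℝ (δ i) x := by
    unfold projCoef
    congr!
  rw [h2, Matrix.inv_def, Ring.inverse_eq_inv', Matrix.smul_mulVec]
  rfl

theorem continuous_adjugate_gram_mulVec [DecidableEq ι] (i : ι) :
    Continuous fun p : (ι → E) × E =>
      ((Matrix.gram ℝ p.1).adjugate.mulVec fun i => inner ℝ (p.1 i) p.2) i := by
  have h1 : Continuous fun p : (ι → E) × E => Matrix.gram ℝ p.1 := by
    refine continuous_matrix fun i j => ?_
    simp only [Matrix.gram_apply]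
    fun_prop
  have h2 : Continuous fun p : (ι → E) × E =>
      ((Matrix.gram ℝ p.1).adjugate.mulVec fun i => inner ℝ (p.1 i) p.2) := by
    refine Continuous.matrix_mulVec h1.matrix_adjugate ?_
    fun_prop
  exact (continuous_apply i).comp h2

variable [FiniteDimensional ℝ E] [MeasurableSpace E] [BorelSpace E]

theorem measurable_projCoef (i : ι) : Measurable fun p : (ι → E) × E => projCoef p.1 p.2 i := by
  classical
  simp only [projCoef_eq_inv_det]
  exact ((continuous_det_gram.comp continuous_fst).measurable.inv).mul
    (continuous_adjugate_gram_mulVec i).measurable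

theorem measurable_projRes : Measurable fun p : (ι → E) × E => projRes p.1 p.2 := by
  unfold projRes
  refine measurable_snd.sub (Finset.measurable_sum _ fun i _ => ?_)
  exact (measurable_projCoef i).smul ((measurable_pi_apply i).comp measurable_fst)

end Measurability

section Slices

variable {E : Type*} [NormedAddCommGroup E] [InnerProductSpace ℝ E] [FiniteDimensional ℝ E]
  [MeasurableSpace E] [BorelSpace E]

open scoped ENNReal

theorem lintegral_eq_lintegral_slices {v : E} (hv : ‖v‖ = 1) {f : E → ℝ≥0∞} (hf : Measurable f) :
    ∫⁻ x, f x = ∫⁻ h : ℝ, ∫⁻ y : (Submodule.span ℝ {v})ᗮ, f (h • v + y) := by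
  let K := Submodule.span ℝ {v}
  have e1 : MeasurePreserving (LinearIsometryEquiv.toSpanUnitSingleton (𝕜 := ℝ) v hv) :=
    LinearIsometryEquiv.measurePreserving _
  have e2 : MeasurePreserving
      (Prod.map (LinearIsometryEquiv.toSpanUnitSingleton (𝕜 := ℝ) v hv) (id : Kᗮ → Kᗮ)) :=
    e1.prod (MeasurePreserving.id _)
  have e3 := (WithLp.volume_preserving_toLp (U := K) (V := Kᗮ)).comp e2
  have e4 := (K.orthogonalDecomposition.symm.measurePreserving).comp e3
  rw [← e4.lintegral_comp hf, Measure.volume_eq_prod, lintegral_prod]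
  · rfl
  · exact (hf.comp e4.measurable).aemeasurable

theorem lintegral_comp_smul {F : Type*} [NormedAddCommGroup F] [NormedSpace ℝ F]
    [FiniteDimensional ℝ F] [MeasurableSpace F] [BorelSpace F] (μ : Measure F)
    [μ.IsAddHaarMeasure] {f : F → ℝ≥0∞} (hf : Measurable f) {c : ℝ} (hc : c ≠ 0) :
    ∫⁻ y, f (c • y) ∂μ = ENNReal.ofReal |(c ^ Module.finrank ℝ F)⁻¹| * ∫⁻ y, f y ∂μ := by
  have := lintegral_map (μ := μ) hf (measurable_const_smul c)
  rw [← this, Measure.map_addHaar_smul μ hc, lintegral_smul_measure, smul_eq_mul]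

end Slices

section Core

open scoped ENNReal

variable {E : Type*} [NormedAddCommGroup E] {ι : Type*} [Fintype ι]

/-- The beta density without its normalising constant. -/
def betaWeight (β : ℝ) (y : E) : ℝ≥0∞ :=
  if ‖y‖ < 1 then ENNReal.ofReal ((1 - ‖y‖ ^ 2) ^ β) else 0

@[fun_prop]
theorem measurable_betaWeight [MeasurableSpace E] [BorelSpace E] (β : ℝ) :
    Measurable (betaWeight β : E → ℝ≥0∞) := by
  unfold betaWeight
  exact Measurable.ite (measurableSet_lt (by fun_prop) (by fun_prop)) (by fun_prop) (by fun_prop)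

/-- The product of the weights of the points `y` and `y + δ i`. -/
def betaProd (β : ℝ) (δ : ι → E) (y : E) : ℝ≥0∞ :=
  betaWeight β y * ∏ i, betaWeight β (y + δ i)

variable [InnerProductSpace ℝ E]

theorem norm_sq_smul_add {v z : E} (hv : ‖v‖ = 1) (hz : inner ℝ v z = 0) (h : ℝ) :
    ‖h • v + z‖ ^ 2 = h ^ 2 + ‖z‖ ^ 2 := by
  rw [norm_add_sq_real, norm_smul, real_inner_smul_left, hz, hv]
  simp

theorem inner_coe_orthogonal_span {v : E} (y : (Submodule.span ℝ {v})ᗮ) :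
    inner ℝ v (y : E) = 0 :=
  Submodule.mem_orthogonal_singleton_iff_inner_right.1 y.2

theorem betaWeight_smul_add (β : ℝ) {v z : E} (hv : ‖v‖ = 1) (hz : inner ℝ v z = 0) {h : ℝ}
    (hh : h ∈ Set.Ioo (-1 : ℝ) 1) :
    betaWeight β (h • v + z) =
      ENNReal.ofReal ((1 - h ^ 2) ^ β) * betaWeight β ((√(1 - h ^ 2))⁻¹ • z) := by
  have h1 : 0 < 1 - h ^ 2 := by nlinarith [hh.1, hh.2]
  have h2 := norm_sq_smul_add hv hz h
  have h3 : ‖(√(1 - h ^ 2))⁻¹ • z‖ ^ 2 = ‖z‖ ^ 2 / (1 - h ^ 2) := by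
    rw [norm_smul, mul_pow, norm_inv, norm_of_nonneg (sqrt_nonneg _), inv_pow, sq_sqrt h1.le]
    field_simp
  have h4 : ‖h • v + z‖ < 1 ↔ ‖(√(1 - h ^ 2))⁻¹ • z‖ < 1 := by
    rw [← sq_lt_one_iff₀ (norm_nonneg _), ← sq_lt_one_iff₀ (norm_nonneg _), h2, h3, div_lt_one h1]
    constructor <;> intro <;> linarith
  unfold betaWeight
  by_cases hlt : ‖h • v + z‖ < 1
  · rw [if_pos hlt, if_pos (h4.1 hlt), ← ENNReal.ofReal_mul (by positivity), ← mul_rpow h1.le,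
      h2, h3]
    · congr 2
      field_simp
      ring
    · rw [sub_nonneg]
      exact ((sq_lt_one_iff₀ (norm_nonneg _)).2 (h4.1 hlt)).le
  · rw [if_neg hlt, if_neg (h4.not.1 hlt), mul_zero]

theorem betaWeight_smul_add_of_notMem (β : ℝ) {v z : E} (hv : ‖v‖ = 1) (hz : inner ℝ v z = 0)
    {h : ℝ} (hh : h ∉ Set.Ioo (-1 : ℝ) 1) : betaWeight β (h • v + z) = 0 := by
  unfold betaWeight
  rw [if_neg]
  intro hlt
  have h2 := norm_sq_smul_add hv hz h
  have h3 := (sq_lt_one_iff₀ (norm_nonneg _)).2 hlt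
  apply hh
  rw [Set.mem_Ioo, ← abs_lt, ← sq_lt_one_iff_abs_lt_one]
  nlinarith [sq_nonneg ‖z‖]

theorem betaProd_smul_add (β : ℝ) {v z : E} (hv : ‖v‖ = 1) (hz : inner ℝ v z = 0) {δ : ι → E}
    (hδ : ∀ i, inner ℝ v (δ i) = 0) {h : ℝ} (hh : h ∈ Set.Ioo (-1 : ℝ) 1) :
    betaProd β δ (h • v + z) = ENNReal.ofReal ((1 - h ^ 2) ^ (β * (Fintype.card ι + 1))) *
      betaProd β ((√(1 - h ^ 2))⁻¹ • δ) ((√(1 - h ^ 2))⁻¹ • z) := by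
  have h1 : 0 < 1 - h ^ 2 := by nlinarith [hh.1, hh.2]
  unfold betaProd
  have : ∀ i, betaWeight β (h • v + z + δ i) = ENNReal.ofReal ((1 - h ^ 2) ^ β) *
      betaWeight β ((√(1 - h ^ 2))⁻¹ • z + ((√(1 - h ^ 2))⁻¹ • δ) i) := by
    intro i
    rw [add_assoc, betaWeight_smul_add β hv _ hh, Pi.smul_apply, smul_add]
    rw [inner_add_right, hz, hδ, add_zero]
  simp only [this]
  rw [betaWeight_smul_add β hv hz hh, Finset.prod_mul_distrib, Finset.prod_const,
    Finset.card_univ, mul_add, mul_one, rpow_add h1, rpow_mul h1.le, rpow_natCast,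
    ENNReal.ofReal_mul (by positivity), ENNReal.ofReal_pow (by positivity)]
  ring

variable [FiniteDimensional ℝ E] [MeasurableSpace E] [BorelSpace E]

theorem measurable_betaProd (β : ℝ) :
    Measurable fun p : (ι → E) × E => betaProd β p.1 p.2 := by
  unfold betaProd
  fun_prop

/-- The mass of the weight in the hyperplane section orthogonal to `v`, expressed as a volume
integral so that it is jointly measurable. -/
def sectionMass (β : ℝ) (v : E) (δ : ι → E) : ℝ≥0∞ :=
  ∫⁻ x : E, (Set.Ioo (0 : ℝ) 1).indicator 1 (inner ℝ v x) * betaProd β δ (x - (inner ℝ v x : ℝ) • v)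

theorem measurable_sectionMass (β : ℝ) :
    Measurable fun p : E × (ι → E) => sectionMass β p.1 p.2 := by
  unfold sectionMass
  refine Measurable.lintegral_prod_right' (f := fun q : (E × (ι → E)) × E =>
    (Set.Ioo (0 : ℝ) 1).indicator 1 (inner ℝ q.1.1 q.2) *
      betaProd β q.1.2 (q.2 - (inner ℝ q.1.1 q.2 : ℝ) • q.1.1)) ?_
  have h1 : Measurable fun q : (E × (ι → E)) × E => (inner ℝ q.1.1 q.2 : ℝ) := by fun_prop
  refine Measurable.mul ?_ ?_
  · exact (measurable_one.indicator measurableSet_Ioo).comp h1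
  · exact (measurable_betaProd β).comp ((measurable_snd.comp measurable_fst).prodMk
      (measurable_snd.sub (h1.smul (measurable_fst.comp measurable_fst))))

theorem sectionMass_eq (β : ℝ) {v : E} (hv : ‖v‖ = 1) (δ : ι → E) :
    sectionMass β v δ = ∫⁻ y : (Submodule.span ℝ {v})ᗮ, betaProd β δ y := by
  unfold sectionMass
  rw [lintegral_eq_lintegral_slices hv]
  · have : ∀ (h : ℝ) (y : (Submodule.span ℝ {v})ᗮ), inner ℝ v (h • v + y : E) = h := by
      intro h y
      rw [inner_add_right, inner_coe_orthogonal_span, real_inner_smul_right,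
        real_inner_self_eq_norm_sq, hv]
      simp
    simp only [this, add_sub_cancel_left]
    have h2 : ∀ h : ℝ, ∫⁻ y : (Submodule.span ℝ {v})ᗮ,
        (Set.Ioo (0 : ℝ) 1).indicator 1 h * betaProd β δ (y : E) =
        (Set.Ioo (0 : ℝ) 1).indicator 1 h *
          ∫⁻ y : (Submodule.span ℝ {v})ᗮ, betaProd β δ (y : E) := by
      intro h
      rw [lintegral_const_mul]
      exact (measurable_betaProd β).comp (measurable_const.prodMk measurable_subtype_coe)
    simp only [h2]
    rw [lintegral_mul_const _ (measurable_one.indicator measurableSet_Ioo),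
      lintegral_indicator_one measurableSet_Ioo]
    simp
  · have h1 : Measurable fun q : E => (inner ℝ v q : ℝ) := by fun_prop
    refine Measurable.mul ?_ ?_
    · exact (measurable_one.indicator measurableSet_Ioo).comp h1
    · exact (measurable_betaProd β).comp (measurable_const.prodMk
        (measurable_id.sub (h1.smul measurable_const)))

theorem lintegral_betaProd_slice (β : ℝ) {v : E} (hv : ‖v‖ = 1) {δ : ι → E}
    (hδ : ∀ i, inner ℝ v (δ i) = 0) {φ : ℝ → ℝ≥0∞} (hφ : Measurable φ) :
    ∫⁻ y, φ (inner ℝ v y) * betaProd β δ y = ∫⁻ h in Set.Ioo (-1 : ℝ) 1, φ h *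
      ENNReal.ofReal ((1 - h ^ 2) ^
        (β * (Fintype.card ι + 1) + ((Module.finrank ℝ E : ℝ) - 1) / 2)) *
        sectionMass β v ((√(1 - h ^ 2))⁻¹ • δ) := by
  have hfin : Module.finrank ℝ (Submodule.span ℝ {v})ᗮ + 1 = Module.finrank ℝ E := by
    have hv0 : v ≠ 0 := by rintro rfl; simp at hv
    have := (Submodule.span ℝ {v}).finrank_add_finrank_orthogonal
    rw [finrank_span_singleton hv0] at this
    omega
  have hfin' : (Module.finrank ℝ E : ℝ) - 1 = Module.finrank ℝ (Submodule.span ℝ {v})ᗮ := by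
    rw [← hfin]; push_cast; ring
  have hm : ∀ h : ℝ, ∀ δ : ι → E, Measurable fun y : (Submodule.span ℝ {v})ᗮ =>
      betaProd β δ (h • v + y) := fun h δ =>
    (measurable_betaProd β).comp (measurable_const.prodMk
        (measurable_const.add measurable_subtype_coe))
  rw [lintegral_eq_lintegral_slices hv]
  swap
  · have h1 : Measurable fun q : E => (inner ℝ v q : ℝ) := by fun_prop
    exact (hφ.comp h1).mul ((measurable_betaProd β).comp (measurable_const.prodMk measurable_id))
  rw [← lintegral_indicator measurableSet_Ioo]
  refine lintegral_congr fun h => ?_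
  have : ∀ (y : (Submodule.span ℝ {v})ᗮ), inner ℝ v (h • v + y : E) = h := by
    intro y
    rw [inner_add_right, inner_coe_orthogonal_span, real_inner_smul_right,
      real_inner_self_eq_norm_sq, hv]
    simp
  simp only [this]
  rw [lintegral_const_mul _ (hm h δ)]
  by_cases hh : h ∈ Set.Ioo (-1 : ℝ) 1
  · rw [Set.indicator_of_mem hh, mul_assoc]
    congr 1
    have h1 : 0 < 1 - h ^ 2 := by nlinarith [hh.1, hh.2]
    simp only [fun y : (Submodule.span ℝ {v})ᗮ =>
      betaProd_smul_add β hv (inner_coe_orthogonal_span y) hδ hh]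
    rw [lintegral_const_mul]
    swap
    · exact (measurable_betaProd β).comp (measurable_const.prodMk
        (measurable_const_smul _ |>.comp measurable_subtype_coe))
    rw [rpow_add h1, ENNReal.ofReal_mul (by positivity), mul_assoc, sectionMass_eq β hv]
    congr 1
    have hr : 0 < √(1 - h ^ 2) := sqrt_pos.2 h1
    have hm' := (measurable_betaProd (E := E) β).comp (measurable_const (a :=
      ((√(1 - h ^ 2))⁻¹ • δ)) |>.prodMk (measurable_subtype_coe (p := (· ∈ (Submodule.span ℝ {v})ᗮ))))
    have := lintegral_comp_smul (volume : Measure (Submodule.span ℝ {v})ᗮ) hm' (inv_ne_zero hr.ne')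
    refine this.trans ?_
    congr 1
    rw [inv_pow, inv_inv, abs_of_pos (by positivity), hfin', sqrt_eq_rpow, ← rpow_natCast,
      ← rpow_mul h1.le]
    congr 2
    ring
  · rw [Set.indicator_of_notMem hh]
    have : ∀ y : (Submodule.span ℝ {v})ᗮ, betaProd β δ (h • v + (y : E)) = 0 := by
      intro y
      unfold betaProd
      rw [betaWeight_smul_add_of_notMem β hv (inner_coe_orthogonal_span y) hh, zero_mul]
    simp [this]

end Core

section Ratio

variable {E : Type*} [NormedAddCommGroup E] [InnerProductSpace ℝ E] [FiniteDimensional ℝ E]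
  [MeasurableSpace E] [BorelSpace E] {ι : Type*} [Fintype ι]

open scoped ENNReal

/-- The exponent of the density of the distance from the origin to the affine hull of `s` points,
in the direction orthogonal to it. -/
def sliceExp (a : ℝ) (s : ℕ) : ℝ := (s * (2 * a + 1) - 1) / 2

/-- The integral of `φ` against the unnormalised density of that distance. -/
def sliceInt (a : ℝ) (s : ℕ) (φ : ℝ → ℝ≥0∞) : ℝ≥0∞ :=
  ∫⁻ h in Set.Ioo (-1 : ℝ) 1, φ h * ENNReal.ofReal ((1 - h ^ 2) ^ sliceExp a s)

theorem lintegral_betaProd_inner (β : ℝ) {V : (ι → E) → E} (hVm : Measurable V)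
    (hVs : ∀ c : ℝ, 0 < c → ∀ δ, V (c • δ) = V δ)
    (hV : ∀ᵐ δ : ι → E, ‖V δ‖ = 1 ∧ ∀ i, inner ℝ (V δ) (δ i) = 0)
    {g : (ι → E) → ℝ≥0∞} (hg : Measurable g) (hgs : ∀ c : ℝ, 0 < c → ∀ δ, g (c • δ) = g δ)
    {φ : ℝ → ℝ≥0∞} (hφ : Measurable φ) :
    ∫⁻ δ : ι → E, g δ * ∫⁻ y, φ (inner ℝ (V δ) y) * betaProd β δ y =
      sliceInt (β + ((Module.finrank ℝ E : ℝ) - 1) / 2) (Fintype.card ι + 1) φ *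
        ∫⁻ δ : ι → E, g δ * sectionMass β (V δ) δ := by
  set e : ℝ := β * (Fintype.card ι + 1) + ((Module.finrank ℝ E : ℝ) - 1) / 2 with he
  have hm1 : Measurable fun h : ℝ => φ h * ENNReal.ofReal ((1 - h ^ 2) ^ e) := by fun_prop
  calc _ = ∫⁻ δ : ι → E, ∫⁻ h in Set.Ioo (-1 : ℝ) 1, (φ h * ENNReal.ofReal ((1 - h ^ 2) ^ e)) *
        (g δ * sectionMass β (V δ) ((√(1 - h ^ 2))⁻¹ • δ)) := by
        refine lintegral_congr_ae (hV.mono fun δ hδ => ?_)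
        simp only
        rw [lintegral_betaProd_slice β hδ.1 hδ.2 hφ, ← lintegral_const_mul]
        · refine lintegral_congr fun h => ?_
          rw [← he]
          ring
        · refine hm1.mul ((measurable_sectionMass β).comp (measurable_const.prodMk ?_))
          fun_prop
    _ = ∫⁻ h in Set.Ioo (-1 : ℝ) 1, ∫⁻ δ : ι → E, (φ h * ENNReal.ofReal ((1 - h ^ 2) ^ e)) *
        (g δ * sectionMass β (V δ) ((√(1 - h ^ 2))⁻¹ • δ)) := by
        refine lintegral_lintegral_swap (Measurable.aemeasurable ?_)
        refine (hm1.comp measurable_snd).mul ((hg.comp measurable_fst).mul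
          ((measurable_sectionMass β).comp ((hVm.comp measurable_fst).prodMk ?_)))
        fun_prop
    _ = ∫⁻ h in Set.Ioo (-1 : ℝ) 1, (φ h * ENNReal.ofReal ((1 - h ^ 2) ^
        sliceExp (β + ((Module.finrank ℝ E : ℝ) - 1) / 2) (Fintype.card ι + 1))) *
        ∫⁻ δ : ι → E, g δ * sectionMass β (V δ) δ := by
        refine setLIntegral_congr_fun measurableSet_Ioo fun h hh => ?_
        have h1 : 0 < 1 - h ^ 2 := by nlinarith [hh.1, hh.2]
        have hr : 0 < √(1 - h ^ 2) := sqrt_pos.2 h1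
        have hmδ : Measurable fun δ : ι → E => g δ * sectionMass β (V δ) δ :=
          hg.mul ((measurable_sectionMass β).comp (hVm.prodMk measurable_id))
        have hsc : ∀ δ : ι → E, g δ * sectionMass β (V δ) ((√(1 - h ^ 2))⁻¹ • δ) =
            (fun δ : ι → E => g δ * sectionMass β (V δ) δ) ((√(1 - h ^ 2))⁻¹ • δ) := by
          intro δ
          simp only
          rw [hVs _ (inv_pos.2 hr), hgs _ (inv_pos.2 hr)]
        rw [lintegral_const_mul]
        swap
        · simp only [hsc]
          exact hmδ.comp (measurable_const_smul _)
        simp only [hsc]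
        rw [lintegral_comp_smul _ hmδ (inv_ne_zero hr.ne'), ← mul_assoc]
        congr 1
        rw [mul_assoc, ← ENNReal.ofReal_mul (by positivity)]
        congr 2
        generalize 1 - h ^ 2 = r at h1 hr
        rw [inv_pow, inv_inv, abs_of_pos (by positivity), sqrt_eq_rpow, ← rpow_natCast,
          ← rpow_mul h1.le, ← rpow_add h1, he, sliceExp]
        congr 1
        rw [Module.finrank_pi_fintype]
        simp
        ring
    _ = _ := by
        rw [lintegral_mul_const, sliceInt]
        fun_prop

end Ratio

section PiDensity

open scoped ENNReal

variable {α : Type*} [MeasurableSpace α]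

theorem lintegral_fin_pi_prod (ν : Measure α) [SigmaFinite ν] :
    ∀ (n : ℕ) (f : Fin n → α → ℝ≥0∞), (∀ i, Measurable (f i)) →
      ∫⁻ x, ∏ i, f i (x i) ∂(Measure.pi fun _ : Fin n => ν) = ∏ i, ∫⁻ y, f i y ∂ν
  | 0, f, hf => by simp
  | n + 1, f, hf => by
    have h := (measurePreserving_piFinSuccAbove (fun _ : Fin (n + 1) => ν) 0).symm
    have hm : ∀ (m : ℕ) (f : Fin m → α → ℝ≥0∞), (∀ i, Measurable (f i)) →
        Measurable fun x : Fin m → α => ∏ i, f i (x i) := fun m f hf =>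
      Finset.measurable_prod _ fun i _ => (hf i).comp (measurable_pi_apply i)
    rw [← h.lintegral_comp (hm _ f hf)]
    refine (lintegral_prod _ ((hm _ f hf).comp h.measurable).aemeasurable).trans ?_
    simp only [Function.comp_apply]
    have : ∀ (y : α) (x : Fin n → α), ∏ i, f i ((MeasurableEquiv.piFinSuccAbove
        (fun _ : Fin (n + 1) => α) 0).symm (y, x) i) = f 0 y * ∏ i, f i.succ (x i) := by
      intro y x
      rw [Fin.prod_univ_succ]
      simp [MeasurableEquiv.piFinSuccAbove]
    simp only [this]
    have h2 : ∀ y, ∫⁻ x : Fin n → α, f 0 y * ∏ i, f i.succ (x i) ∂(Measure.pi fun _ => ν) =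
        f 0 y * ∏ i : Fin n, ∫⁻ y, f i.succ y ∂ν := by
      intro y
      rw [lintegral_const_mul _ (hm _ _ fun i => hf _), lintegral_fin_pi_prod ν n _ fun i => hf _]
    simp only [h2]
    rw [lintegral_mul_const _ (hf 0), Fin.prod_univ_succ]

theorem lintegral_pi_prod {ι : Type*} [Fintype ι] (ν : Measure α) [SigmaFinite ν]
    (f : ι → α → ℝ≥0∞) (hf : ∀ i, Measurable (f i)) :
    ∫⁻ x, ∏ i, f i (x i) ∂(Measure.pi fun _ : ι => ν) = ∏ i, ∫⁻ y, f i y ∂ν := by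
  let e := Fintype.equivFin ι
  have h := measurePreserving_piCongrLeft (fun _ : ι => ν) e.symm
  have hm : Measurable fun x : ι → α => ∏ i, f i (x i) :=
    Finset.measurable_prod _ fun i _ => (hf i).comp (measurable_pi_apply i)
  rw [← h.lintegral_comp hm, ← e.symm.prod_comp (fun i => ∫⁻ y, f i y ∂ν),
    ← lintegral_fin_pi_prod ν _ _ fun i => hf _]
  refine lintegral_congr fun x => ?_
  rw [← e.symm.prod_comp]
  simp [MeasurableEquiv.piCongrLeft, Equiv.piCongrLeft_apply]

theorem pi_withDensity {ι : Type*} [Fintype ι] (ν : Measure α) [SigmaFinite ν]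
    {f : α → ℝ≥0∞} (hf : Measurable f) [SigmaFinite (ν.withDensity f)] :
    Measure.pi (fun _ : ι => ν.withDensity f) =
      (Measure.pi fun _ : ι => ν).withDensity fun x => ∏ i, f (x i) := by
  refine Measure.pi_eq fun s hs => ?_
  rw [withDensity_apply _ (MeasurableSet.univ_pi hs),
    ← lintegral_indicator (MeasurableSet.univ_pi hs)]
  have : ∀ i, (ν.withDensity f) (s i) = ∫⁻ y, (s i).indicator f y ∂ν := fun i => by
    rw [withDensity_apply _ (hs i), lintegral_indicator (hs i)]
  simp only [this]
  rw [← lintegral_pi_prod ν _ fun i => hf.indicator (hs i)]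
  refine lintegral_congr fun x => ?_
  by_cases hx : x ∈ Set.univ.pi s
  · rw [Set.indicator_of_mem hx]
    exact Finset.prod_congr rfl fun i _ => (Set.indicator_of_mem (hx i trivial) _).symm
  · rw [Set.indicator_of_notMem hx]
    simp only [Set.mem_pi, Set.mem_univ, forall_true_left, not_forall] at hx
    obtain ⟨i, hi⟩ := hx
    rw [Finset.prod_eq_zero (Finset.mem_univ i)]
    simp [hi]

end PiDensity

section GeneralPosition

open scoped ENNReal

variable {E : Type*} [NormedAddCommGroup E] [InnerProductSpace ℝ E]
  [MeasurableSpace E]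

/-- The measure vanishes on all affine hyperplanes. -/
def NullOnHyperplanes (ν : Measure E) : Prop :=
  ∀ (a : E) (c : ℝ), a ≠ 0 → ν {y | inner ℝ a y = c} = 0

theorem NullOnHyperplanes.mono {ν ν' : Measure E} (h : NullOnHyperplanes ν) (h' : ν' ≪ ν) :
    NullOnHyperplanes ν' := fun a c ha => h' (h a c ha)

variable [FiniteDimensional ℝ E]

theorem NullOnHyperplanes.submodule {ν : Measure E} (h : NullOnHyperplanes ν)
    {M : Submodule ℝ E} (hM : M ≠ ⊤) (c : E) : ν {y | y - c ∈ M} = 0 := by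
  obtain ⟨a, ha, ha0⟩ := Submodule.exists_mem_ne_zero_of_ne_bot
    (mt Submodule.orthogonal_eq_bot_iff.1 hM)
  refine measure_mono_null (fun y hy => ?_) (h a (inner ℝ a c) ha0)
  have := (Submodule.mem_orthogonal' M a).1 ha _ hy
  rw [inner_sub_right, sub_eq_zero] at this
  exact this

variable [BorelSpace E]

theorem nullOnHyperplanes_volume : NullOnHyperplanes (volume : Measure E) := by
  intro a c ha
  let S : AffineSubspace ℝ E := AffineSubspace.mk' ((c / ‖a‖ ^ 2) • a) (Submodule.span ℝ {a})ᗮ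
  have hS : (S : Set E) = {y | inner ℝ a y = c} := by
    ext y
    change y ∈ AffineSubspace.mk' _ _ ↔ _
    rw [AffineSubspace.mem_mk', Submodule.mem_orthogonal_singleton_iff_inner_right, vsub_eq_sub,
      inner_sub_right, real_inner_smul_right, real_inner_self_eq_norm_sq, sub_eq_zero,
      div_mul_cancel₀ _ (by simpa using ha)]
    rfl
  rw [← hS]
  refine Measure.addHaar_affineSubspace _ _ fun htop => ha ?_
  have h1 : (S : Set E) = Set.univ := by rw [htop]; rfl
  rw [hS] at h1
  have h2 : (0 : E) ∈ {y | inner ℝ a y = c} := by rw [h1]; trivial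
  have h3 : a ∈ {y | inner ℝ a y = c} := by rw [h1]; trivial
  simp only [Set.mem_ofPred_eq, inner_zero_right] at h2 h3
  rw [← h2] at h3
  exact inner_self_eq_zero.1 h3

variable {F : Type*} [NormedAddCommGroup F] [NormedSpace ℝ F]

theorem measurableSet_linearIndependent_map (T : E →L[ℝ] F) (c : E) (ι : Type*) [Finite ι] :
    MeasurableSet {X : ι → E | LinearIndependent ℝ fun i => T (X i - c)} := by
  have h : IsOpen {X : ι → F | LinearIndependent ℝ X} := isOpen_setOfPred_linearIndependent
  exact (h.preimage (f := fun (X : ι → E) i => T (X i - c)) (by fun_prop)).measurableSet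

variable [FiniteDimensional ℝ F]

theorem NullOnHyperplanes.ae_linearIndependent_fin {ν : Measure E} [SigmaFinite ν]
    (h : NullOnHyperplanes ν) (T : E →L[ℝ] F) (c : E) :
    ∀ n : ℕ, n ≤ Module.finrank ℝ (LinearMap.range (T : E →ₗ[ℝ] F)) →
      ∀ᵐ X ∂(Measure.pi fun _ : Fin n => ν), LinearIndependent ℝ fun i => T (X i - c)
  | 0, _ => by
    filter_upwards with X
    exact linearIndependent_empty_type
  | n + 1, hn => by
    have ih := h.ae_linearIndependent_fin T c n (by omega)
    have hmp := (measurePreserving_piFinSuccAbove (fun _ : Fin (n + 1) => ν) 0).symm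
    rw [← hmp.map_eq, ae_map_iff hmp.measurable.aemeasurable
      (measurableSet_linearIndependent_map T c _)]
    have hms := hmp.measurable (measurableSet_linearIndependent_map T c (Fin (n + 1)))
    have hcons : ∀ (y : E) (X : Fin n → E), (LinearIndependent ℝ fun i => T
        ((MeasurableEquiv.piFinSuccAbove (fun _ : Fin (n + 1) => E) 0).symm (y, X) i - c)) ↔
        LinearIndependent ℝ (fun i => T (X i - c)) ∧
          T (y - c) ∉ Submodule.span ℝ (Set.range fun i => T (X i - c)) := by
      intro y X
      rw [← linearIndependent_finCons]
      have : (fun i => T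
          ((MeasurableEquiv.piFinSuccAbove (fun _ : Fin (n + 1) => E) 0).symm (y, X) i - c)) =
          Fin.cons (T (y - c)) fun i => T (X i - c) := by
        funext i
        refine Fin.cases ?_ (fun i => ?_) i <;> simp [MeasurableEquiv.piFinSuccAbove]
      rw [this]
    rw [← Measure.prod_swap, ae_map_iff measurable_swap.aemeasurable]
    swap
    · exact hms
    refine (Measure.ae_prod_iff_ae_ae (measurable_swap hms)).2 ?_
    filter_upwards [ih] with X hX
    let M := (Submodule.span ℝ (Set.range fun i => T (X i - c))).comap (T : E →ₗ[ℝ] F)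
    have hM : M ≠ ⊤ := by
      intro htop
      have h1 : LinearMap.range (T : E →ₗ[ℝ] F) ≤
          Submodule.span ℝ (Set.range fun i => T (X i - c)) := by
        rintro _ ⟨y, rfl⟩
        have : y ∈ M := by rw [htop]; trivial
        exact this
      have h2 := Submodule.finrank_mono h1
      have h3 := finrank_range_le_card (R := ℝ) fun i => T (X i - c)
      simp only [Fintype.card_fin] at h3
      have h4 : Module.finrank ℝ (Submodule.span ℝ (Set.range fun i => T (X i - c))) ≤ n := h3
      omega
    have := h.submodule hM c
    rw [measure_eq_zero_iff_ae_notMem] at this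
    filter_upwards [this] with y hy
    exact (hcons y X).2 ⟨hX, hy⟩

theorem NullOnHyperplanes.ae_linearIndependent {ν : Measure E} [SigmaFinite ν]
    (h : NullOnHyperplanes ν) (T : E →L[ℝ] F) (c : E) {ι : Type*} [Fintype ι]
    (hn : Fintype.card ι ≤ Module.finrank ℝ (LinearMap.range (T : E →ₗ[ℝ] F))) :
    ∀ᵐ X ∂(Measure.pi fun _ : ι => ν), LinearIndependent ℝ fun i => T (X i - c) := by
  let e := Fintype.equivFin ι
  have hmp := measurePreserving_piCongrLeft (fun _ : ι => ν) e.symm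
  rw [← hmp.map_eq, ae_map_iff hmp.measurable.aemeasurable
    (measurableSet_linearIndependent_map T c _)]
  filter_upwards [h.ae_linearIndependent_fin T c _ hn] with X hX
  rw [← linearIndependent_equiv e.symm]
  convert hX using 1
  funext i
  simp [MeasurableEquiv.piCongrLeft, Equiv.piCongrLeft_apply]

theorem NullOnHyperplanes.ae_linearIndependent_sub {ν : Measure E} [SigmaFinite ν]
    (h : NullOnHyperplanes ν) (c : E) {ι : Type*} [Fintype ι]
    (hn : Fintype.card ι ≤ Module.finrank ℝ E) :
    ∀ᵐ X ∂(Measure.pi fun _ : ι => ν), LinearIndependent ℝ fun i => X i - c := by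
  refine h.ae_linearIndependent (ContinuousLinearMap.id ℝ E) c ?_
  have : LinearMap.range ((ContinuousLinearMap.id ℝ E : E →L[ℝ] E) : E →ₗ[ℝ] E) = ⊤ :=
    LinearMap.range_id
  rwa [this, finrank_top]

theorem NullOnHyperplanes.ae_projRes_ne_zero {ν : Measure E} [SigmaFinite ν]
    (h : NullOnHyperplanes ν) {x : E} (hx : x ≠ 0) {ι : Type*} [Fintype ι]
    (hn : Fintype.card ι < Module.finrank ℝ E) :
    ∀ᵐ X ∂(Measure.pi fun _ : ι => ν), projRes X x ≠ 0 := by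
  let T : E →L[ℝ] (Submodule.span ℝ {x})ᗮ := (Submodule.span ℝ {x})ᗮ.orthogonalProjectionOnto
  have hT : Module.finrank ℝ (LinearMap.range (T : E →ₗ[ℝ] (Submodule.span ℝ {x})ᗮ)) + 1 =
      Module.finrank ℝ E := by
    have h1 : LinearMap.range (T : E →ₗ[ℝ] (Submodule.span ℝ {x})ᗮ) = ⊤ := by
      rw [LinearMap.range_eq_top]
      intro y
      exact ⟨y, Submodule.orthogonalProjectionOnto_mem_subspace_eq_self y⟩
    rw [h1, finrank_top]
    have := (Submodule.span ℝ {x}).finrank_add_finrank_orthogonal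
    rw [finrank_span_singleton hx] at this
    omega
  have hTx : T x = 0 := by
    rw [Submodule.orthogonalProjectionOnto_eq_zero_iff, Submodule.orthogonal_orthogonal]
    exact Submodule.mem_span_singleton_self x
  filter_upwards [h.ae_linearIndependent T 0 (ι := ι) (by omega)] with X hX h0
  simp only [sub_zero] at hX
  have h1 : ∑ i, projCoef X x i • T (X i) = 0 := by
    have := congrArg T h0
    rw [projRes, map_sub, hTx, map_sum, zero_sub, map_zero, neg_eq_zero] at this
    simpa using this
  have h2 := Fintype.linearIndependent_iff.1 hX _ h1
  rw [projRes] at h0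
  simp only [h2, zero_smul, Finset.sum_const_zero, sub_zero] at h0
  exact hx h0

end GeneralPosition

section BetaSlices

open scoped ENNReal

variable {d : ℕ} {β : ℝ}

local notation "𝔼" => EuclideanSpace ℝ (Fin d)

theorem betaMeasure_eq_withDensity (hβ : -1 < β) : ∃ C : ℝ≥0∞,
    betaMeasure d β = volume.withDensity fun x => C * betaWeight β x := by
  refine ⟨ENNReal.ofReal (Real.Gamma ((d : ℝ) / 2 + β + 1) /
    (Real.pi ^ ((d : ℝ) / 2) * Real.Gamma (β + 1))), ?_⟩
  rw [betaMeasure, if_neg hβ.ne']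
  congr 1
  funext x
  rw [betaDensity, ENNReal.ofReal_mul]
  · congr 1
    unfold betaWeight
    split_ifs <;> simp
  · have h1 : 0 < Real.Gamma ((d : ℝ) / 2 + β + 1) := by
      refine Real.Gamma_pos_of_pos ?_
      have : (0 : ℝ) ≤ d / 2 := by positivity
      linarith
    have h2 : 0 < Real.Gamma (β + 1) := Real.Gamma_pos_of_pos (by linarith)
    positivity

theorem exists_lintegral_betaMeasure_sub (hβ : -1 < β) [IsProbabilityMeasure (betaMeasure d β)]
    (ι : Type*) [Fintype ι] : ∃ C : ℝ≥0∞, ∀ F : (ι → 𝔼) × 𝔼 → ℝ≥0∞, Measurable F →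
      ∫⁻ y, ∫⁻ X, F (fun i => X i - y, y) ∂(Measure.pi fun _ : ι => betaMeasure d β)
        ∂(betaMeasure d β) = C * ∫⁻ δ : ι → 𝔼, ∫⁻ y, F (δ, y) * betaProd β δ y := by
  obtain ⟨C, hC⟩ := betaMeasure_eq_withDensity (d := d) hβ
  refine ⟨C ^ (Fintype.card ι + 1), fun F hF => ?_⟩
  set f : 𝔼 → ℝ≥0∞ := fun x => C * betaWeight β x with hf
  have hfm : Measurable f := (measurable_betaWeight β).const_mul C
  have : IsProbabilityMeasure (volume.withDensity f) := hC ▸ ‹IsProbabilityMeasure (betaMeasure d β)›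
  rw [hC, pi_withDensity _ hfm]
  have hpm : Measurable fun X : ι → 𝔼 => ∏ i, f (X i) :=
    Finset.measurable_prod _ fun i _ => hfm.comp (measurable_pi_apply i)
  have hsub : Measurable fun p : 𝔼 × (ι → 𝔼) => ((fun i => p.2 i - p.1, p.1) : (ι → 𝔼) × 𝔼) := by
    fun_prop
  have hin : ∀ y : 𝔼, ∫⁻ X, F (fun i => X i - y, y)
      ∂((Measure.pi fun _ : ι => (volume : Measure 𝔼)).withDensity fun X => ∏ i, f (X i)) =
      ∫⁻ δ : ι → 𝔼, (∏ i, f (y + δ i)) * F (δ, y) := by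
    intro y
    have hFy : Measurable fun X : ι → 𝔼 => F (fun i => X i - y, y) :=
      (hF.comp hsub).comp (measurable_const.prodMk measurable_id)
    rw [lintegral_withDensity_eq_lintegral_mul _ hpm hFy, ← volume_pi,
      ← lintegral_add_right_eq_self _ (fun _ : ι => y)]
    simp [add_comm]
  simp only [hin]
  have hm2 : Measurable fun p : 𝔼 × (ι → 𝔼) => (∏ i, f (p.1 + p.2 i)) * F (p.2, p.1) := by
    refine Measurable.mul (Finset.measurable_prod _ fun i _ => hfm.comp ?_)
      (hF.comp measurable_swap)
    fun_prop
  rw [lintegral_withDensity_eq_lintegral_mul _ hfm hm2.lintegral_prod_right']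
  have hpull : ∀ y, (f * fun y => ∫⁻ δ : ι → 𝔼, (∏ i, f (y + δ i)) * F (δ, y)) y =
      ∫⁻ δ : ι → 𝔼, C ^ (Fintype.card ι + 1) * (F (δ, y) * betaProd β δ y) := by
    intro y
    have hmy : Measurable fun δ : ι → 𝔼 => (∏ i, f (y + δ i)) * F (δ, y) :=
      (Finset.measurable_prod _ fun i _ => hfm.comp (by fun_prop)).mul
        (hF.comp measurable_prodMk_right)
    rw [Pi.mul_apply, ← lintegral_const_mul _ hmy]
    refine lintegral_congr fun δ => ?_
    simp only [hf, betaProd, Finset.prod_mul_distrib, Finset.prod_const, Finset.card_univ]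
    ring
  have hm3 : Measurable fun p : (ι → 𝔼) × 𝔼 => F p * betaProd β p.1 p.2 :=
    hF.mul (measurable_betaProd β)
  simp only [hpull]
  rw [lintegral_lintegral_swap, ← lintegral_const_mul _ hm3.lintegral_prod_right']
  · refine lintegral_congr fun δ => ?_
    have hmδ : Measurable fun y => F (δ, y) * betaProd β δ y :=
      hm3.comp (measurable_prodMk_left (x := δ))
    rw [lintegral_const_mul _ hmδ]
  · exact ((hm3.const_mul _).comp measurable_swap).aemeasurable

/-- The mean of `φ` under the normalised density of the distance from the origin to the affine
hull of `s` points. -/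
def sliceMean (a : ℝ) (s : ℕ) (φ : ℝ → ℝ≥0∞) : ℝ≥0∞ := sliceInt a s φ / sliceInt a s 1

theorem sliceInt_one_ne_zero (a : ℝ) (s : ℕ) : sliceInt a s 1 ≠ 0 := by
  unfold sliceInt
  rw [Ne, lintegral_eq_zero_iff (by simp only [Pi.one_apply]; fun_prop)]
  intro h
  have h1 : ∀ᵐ x ∂(volume.restrict (Set.Ioo (-1 : ℝ) 1)), False := by
    filter_upwards [h, ae_restrict_mem measurableSet_Ioo] with x hx hx'
    have h1 : 0 < 1 - x ^ 2 := by nlinarith [hx'.1, hx'.2]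
    have h2 := rpow_pos_of_pos h1 (sliceExp a s)
    simp only [Pi.one_apply, one_mul, Pi.zero_apply, ENNReal.ofReal_eq_zero] at hx
    linarith
  rw [Filter.eventually_false_iff_eq_bot, ae_eq_bot, Measure.restrict_eq_zero] at h1
  norm_num at h1

theorem sliceExp_nonneg {a : ℝ} (ha : 0 ≤ a) {s : ℕ} (hs : 1 ≤ s) : 0 ≤ sliceExp a s := by
  unfold sliceExp
  have : (1 : ℝ) ≤ s := by exact_mod_cast hs
  nlinarith

theorem sliceInt_one_ne_top {a : ℝ} (ha : 0 ≤ a) {s : ℕ} (hs : 1 ≤ s) : sliceInt a s 1 ≠ ⊤ := by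
  refine ne_top_of_le_ne_top (b := volume (Set.Ioo (-1 : ℝ) 1)) (by simp) ?_
  rw [← setLIntegral_one]
  refine setLIntegral_mono measurable_one fun x hx => ?_
  have h1 : 0 < 1 - x ^ 2 := by nlinarith [hx.1, hx.2]
  simp only [Pi.one_apply, one_mul, ENNReal.ofReal_le_one]
  exact rpow_le_one h1.le (by nlinarith) (sliceExp_nonneg ha hs)

theorem lintegral_betaMeasure_inner (hβ : -1 < β) [IsProbabilityMeasure (betaMeasure d β)]
    (ha : 0 ≤ β + ((d : ℝ) - 1) / 2) {ι : Type*} [Fintype ι] {V : (ι → 𝔼) → 𝔼}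
    (hVm : Measurable V) (hVs : ∀ c : ℝ, 0 < c → ∀ δ, V (c • δ) = V δ)
    (hV : ∀ᵐ δ : ι → 𝔼, ‖V δ‖ = 1 ∧ ∀ i, inner ℝ (V δ) (δ i) = 0)
    {g : (ι → 𝔼) → ℝ≥0∞} (hg : Measurable g) (hgs : ∀ c : ℝ, 0 < c → ∀ δ, g (c • δ) = g δ)
    {φ : ℝ → ℝ≥0∞} (hφ : Measurable φ) {F : (ι → 𝔼) × 𝔼 → ℝ≥0∞} (hF : Measurable F)
    (hFg : ∀ᵐ δ : ι → 𝔼, ∀ y, F (δ, y) = g δ * φ (inner ℝ (V δ) y)) :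
    ∫⁻ y, ∫⁻ X, F (fun i => X i - y, y) ∂(Measure.pi fun _ : ι => betaMeasure d β)
        ∂(betaMeasure d β) =
      sliceMean (β + ((d : ℝ) - 1) / 2) (Fintype.card ι + 1) φ *
        ∫⁻ y, ∫⁻ X, g (fun i => X i - y) ∂(Measure.pi fun _ : ι => betaMeasure d β)
          ∂(betaMeasure d β) := by
  obtain ⟨C, hC⟩ := exists_lintegral_betaMeasure_sub (d := d) hβ ι
  have h1 := hC F hF
  have h2 := hC (fun p => g p.1) (hg.comp measurable_fst)
  simp only at h2
  rw [h1, h2]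
  have key := fun (φ : ℝ → ℝ≥0∞) (hφ : Measurable φ) =>
    lintegral_betaProd_inner β hVm hVs hV hg hgs hφ
  simp only [finrank_euclideanSpace_fin] at key
  have h3 : ∫⁻ δ : ι → 𝔼, ∫⁻ y, F (δ, y) * betaProd β δ y =
      ∫⁻ δ : ι → 𝔼, g δ * ∫⁻ y, φ (inner ℝ (V δ) y) * betaProd β δ y := by
    refine lintegral_congr_ae (hFg.mono fun δ hδ => ?_)
    simp only [hδ]
    rw [← lintegral_const_mul]
    · simp only [mul_assoc]
    · have : Measurable fun y => inner ℝ (V δ) y := by fun_prop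
      exact (hφ.comp this).mul ((measurable_betaProd β).comp (measurable_const.prodMk measurable_id))
  have h4 : ∫⁻ δ : ι → 𝔼, ∫⁻ y, g δ * betaProd β δ y =
      ∫⁻ δ : ι → 𝔼, g δ * ∫⁻ y, (1 : ℝ → ℝ≥0∞) (inner ℝ (V δ) y) * betaProd β δ y := by
    refine lintegral_congr fun δ => ?_
    rw [← lintegral_const_mul]
    · simp
    · simp only [Pi.one_apply, one_mul]
      exact (measurable_betaProd β).comp (measurable_const.prodMk measurable_id)
  rw [h3, h4, key φ hφ, key 1 measurable_one, sliceMean]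
  have e1 := sliceInt_one_ne_zero (β + ((d : ℝ) - 1) / 2) (Fintype.card ι + 1)
  have e2 := sliceInt_one_ne_top ha (Nat.le_add_left 1 (Fintype.card ι))
  set Z := sliceInt (β + ((d : ℝ) - 1) / 2) (Fintype.card ι + 1) 1
  calc _ = (sliceInt (β + ((d : ℝ) - 1) / 2) (Fintype.card ι + 1) φ / Z * Z) *
        (C * ∫⁻ δ : ι → 𝔼, g δ * sectionMass β (V δ) δ) := by
        rw [ENNReal.div_mul_cancel e1 e2]
        ring
    _ = _ := by ring

end BetaSlices

section FaceStep

open scoped ENNReal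

variable {d : ℕ} {β : ℝ}

local notation "𝔼" => EuclideanSpace ℝ (Fin d)

/-- The beta-measure of a half-space at signed distance `h` from the origin. -/
def halfMass (a h : ℝ) : ℝ≥0∞ := sliceMean a 1 ((Set.Iic h).indicator 1)

theorem measurable_halfMass (a : ℝ) : Measurable (halfMass a) := by
  refine Monotone.measurable fun h h' hh => ?_
  refine ENNReal.div_le_div_right (lintegral_mono fun x => ?_) _
  gcongr

theorem betaMeasure_halfSpace (hβ : -1 < β) [IsProbabilityMeasure (betaMeasure d β)]
    (ha : 0 ≤ β + ((d : ℝ) - 1) / 2) {v : 𝔼} (hv : ‖v‖ = 1) (h : ℝ) :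
    betaMeasure d β {z | inner ℝ v z ≤ h} = halfMass (β + ((d : ℝ) - 1) / 2) h := by
  have hm : Measurable fun z : 𝔼 => (inner ℝ v z : ℝ) := by fun_prop
  have hφ : Measurable ((Set.Iic h).indicator (1 : ℝ → ℝ≥0∞)) :=
    measurable_one.indicator measurableSet_Iic
  have := lintegral_betaMeasure_inner (d := d) hβ ha (ι := Fin 0) (V := fun _ => v)
    measurable_const (fun _ _ _ => rfl) (Filter.Eventually.of_forall fun _ => ⟨hv, fun i => i.elim0⟩)
    (g := 1) measurable_one (fun _ _ _ => rfl) hφ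
    (F := fun p => (Set.Iic h).indicator 1 (inner ℝ v p.2)) ((hφ.comp hm).comp measurable_snd)
    (by simp)
  simp only [lintegral_const, measure_univ, mul_one, Pi.one_apply, Fintype.card_fin,
    zero_add] at this
  rw [halfMass, ← this]
  exact (lintegral_indicator_one (μ := betaMeasure d β) (hm (measurableSet_Iic (a := h)))).symm

/-- The weight with which faces of dimension `s - 1` contribute, when `m` further points lie
beyond the face. -/
def faceCoef (a : ℝ) (s m : ℕ) : ℝ≥0∞ := sliceMean a s fun h => halfMass a h ^ m

/-- The event that the coefficients with index in `Q` are positive. -/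
def coefSet {E : Type*} [NormedAddCommGroup E] [InnerProductSpace ℝ E] {ι : Type*} [Fintype ι]
    (Q : Finset ι) (x : E) : Set (ι → E) := {δ | ∀ i ∈ Q, 0 < projCoef δ x i}

theorem measurableSet_coefSet {E : Type*} [NormedAddCommGroup E] [InnerProductSpace ℝ E]
    [FiniteDimensional ℝ E] [MeasurableSpace E] [BorelSpace E] {ι : Type*} [Fintype ι]
    (Q : Finset ι) : MeasurableSet {p : (ι → E) × E | p.1 ∈ coefSet Q p.2} := by
  have : {p : (ι → E) × E | p.1 ∈ coefSet Q p.2} = ⋂ i ∈ Q, {p | 0 < projCoef p.1 p.2 i} := by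
    ext p
    simp [coefSet]
  rw [this]
  exact Finset.measurableSet_biInter _ fun i _ =>
    measurableSet_lt measurable_const (measurable_projCoef i)

/-- The probability that `x` has positive coefficients with index in `Q` with respect to the
edges from a random point to further random points. -/
def coefProb (μ : Measure 𝔼) {ι : Type*} [Fintype ι] (Q : Finset ι) (x : 𝔼) : ℝ≥0∞ :=
  ∫⁻ y, ∫⁻ X, (coefSet Q x).indicator 1 (fun i => X i - y) ∂(Measure.pi fun _ : ι => μ) ∂μ

/-- The families of points lying beyond `y` in direction `-w`. -/
def negSet {E : Type*} [NormedAddCommGroup E] [InnerProductSpace ℝ E] (κ : Type*) (w y : E) :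
    Set (κ → E) := {Z | ∀ j, inner ℝ w (Z j - y) ≤ 0}

theorem measurable_lintegral_face (μ : Measure 𝔼) [SFinite μ] {ι κ : Type*} [Fintype ι]
    [Fintype κ] (Q : Finset ι) (x : 𝔼) :
    Measurable fun q : ((ι → 𝔼) × 𝔼) × (κ → 𝔼) => (coefSet Q x).indicator 1 q.1.1 *
      (negSet κ (projRes q.1.1 x) q.1.2).indicator (1 : (κ → 𝔼) → ℝ≥0∞) q.2 := by
  have hres : Measurable fun q : ((ι → 𝔼) × 𝔼) × (κ → 𝔼) => projRes q.1.1 x :=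
    measurable_projRes.comp
      ((measurable_fst.comp measurable_fst).prodMk measurable_const)
  have h1 : MeasurableSet {q : ((ι → 𝔼) × 𝔼) × (κ → 𝔼) | q.1.1 ∈ coefSet Q x} :=
    (measurableSet_coefSet Q).preimage
      ((measurable_fst.comp measurable_fst).prodMk measurable_const)
  have h2 : MeasurableSet {q : ((ι → 𝔼) × 𝔼) × (κ → 𝔼) |
      q.2 ∈ negSet κ (projRes q.1.1 x) q.1.2} := by
    have : {q : ((ι → 𝔼) × 𝔼) × (κ → 𝔼) | q.2 ∈ negSet κ (projRes q.1.1 x) q.1.2} =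
        ⋂ j, {q | inner ℝ (projRes q.1.1 x) (q.2 j - q.1.2) ≤ 0} := by
      ext q
      simp [negSet]
    rw [this]
    refine MeasurableSet.iInter fun j => measurableSet_le (hres.inner ?_) measurable_const
    exact ((measurable_pi_apply j).comp measurable_snd).sub (measurable_snd.comp measurable_fst)
  exact (measurable_one.indicator h1).mul (measurable_one.indicator h2)

theorem lintegral_negSet (hβ : -1 < β) [IsProbabilityMeasure (betaMeasure d β)]
    (ha : 0 ≤ β + ((d : ℝ) - 1) / 2) (κ : Type*) [Fintype κ] {w : 𝔼} (hw : w ≠ 0) (y : 𝔼) :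
    ∫⁻ Z, (negSet κ w y).indicator 1 Z ∂(Measure.pi fun _ : κ => betaMeasure d β) =
      halfMass (β + ((d : ℝ) - 1) / 2) (inner ℝ (‖w‖⁻¹ • w) y) ^ Fintype.card κ := by
  have hpi : negSet κ w y = Set.univ.pi fun _ : κ =>
      {z | inner ℝ (‖w‖⁻¹ • w) z ≤ inner ℝ (‖w‖⁻¹ • w) y} := by
    ext Z
    simp only [negSet, Set.mem_ofPred_eq, Set.mem_pi, Set.mem_univ, forall_true_left]
    refine forall_congr' fun j => ?_
    rw [real_inner_smul_left, real_inner_smul_left,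
      mul_le_mul_iff_right₀ (inv_pos.2 (norm_pos_iff.2 hw)), inner_sub_right, sub_nonpos]
  have hm : MeasurableSet {z : 𝔼 | inner ℝ (‖w‖⁻¹ • w) z ≤ inner ℝ (‖w‖⁻¹ • w) y} :=
    measurableSet_le (by fun_prop) (by fun_prop)
  rw [hpi, lintegral_indicator_one (MeasurableSet.univ_pi fun _ => hm), Measure.pi_pi,
    betaMeasure_halfSpace hβ ha (by simpa using norm_smul_inv_norm (𝕜 := ℝ) hw)]
  simp

theorem coefSet_indicator_smul {ι : Type*} [Fintype ι] (Q : Finset ι) (x : 𝔼) {c : ℝ}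
    (hc : 0 < c) (δ : ι → 𝔼) : (coefSet Q x).indicator (1 : (ι → 𝔼) → ℝ≥0∞) (c • δ) =
      (coefSet Q x).indicator 1 δ := by
  have : c • δ ∈ coefSet Q x ↔ δ ∈ coefSet Q x := by
    refine forall₂_congr fun i _ => ?_
    rw [projCoef_smul δ x hc.ne', Pi.smul_apply, smul_eq_mul]
    exact mul_pos_iff_of_pos_left (inv_pos.2 hc)
  by_cases h : δ ∈ coefSet Q x
  · rw [Set.indicator_of_mem h, Set.indicator_of_mem (this.2 h)]; rfl
  · rw [Set.indicator_of_notMem h, Set.indicator_of_notMem (mt this.1 h)]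

section
variable {E : Type*} [NormedAddCommGroup E] [InnerProductSpace ℝ E]
    [FiniteDimensional ℝ E] [MeasurableSpace E] [BorelSpace E] {ι : Type*} [Fintype ι]

theorem measurable_projRes_left (x : E) : Measurable fun δ : ι → E => projRes δ x := by
  have h : Measurable fun δ : ι → E => ((δ, x) : (ι → E) × E) := measurable_prodMk_right
  exact measurable_projRes.comp h

theorem measurableSet_coefSet_left (Q : Finset ι) (x : E) :
    MeasurableSet (coefSet Q x : Set (ι → E)) := by
  have : (coefSet Q x : Set (ι → E)) = ⋂ i ∈ Q, {δ | 0 < projCoef δ x i} := by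
    ext p
    simp [coefSet]
  rw [this]
  have h : Measurable fun δ : ι → E => ((δ, x) : (ι → E) × E) := measurable_prodMk_right
  refine Finset.measurableSet_biInter _ fun i _ => measurableSet_lt measurable_const ?_
  have h2 := (measurable_projCoef (E := E) i).comp h
  simp only [Function.comp_def] at h2
  exact h2
end

theorem lintegral_face (hβ : -1 < β) [IsProbabilityMeasure (betaMeasure d β)]
    (ha : 0 ≤ β + ((d : ℝ) - 1) / 2) {ι κ : Type*} [Fintype ι] [Fintype κ]
    (hι : Fintype.card ι < d) (Q : Finset ι) {x : 𝔼} (hx : x ≠ 0) :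
    ∫⁻ y, ∫⁻ X, ∫⁻ Z, (coefSet Q x).indicator 1 (fun i => X i - y) *
        (negSet κ (projRes (fun i => X i - y) x) y).indicator 1 Z
        ∂(Measure.pi fun _ : κ => betaMeasure d β) ∂(Measure.pi fun _ : ι => betaMeasure d β)
        ∂(betaMeasure d β) =
      faceCoef (β + ((d : ℝ) - 1) / 2) (Fintype.card ι + 1) (Fintype.card κ) *
        coefProb (betaMeasure d β) Q x := by
  have hresm : Measurable fun δ : ι → 𝔼 => projRes δ x :=
    measurable_projRes_left x
  have hgm : MeasurableSet (coefSet Q x : Set (ι → 𝔼)) :=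
    measurableSet_coefSet_left Q x
  have hg : Measurable ((coefSet Q x : Set (ι → 𝔼)).indicator (1 : (ι → 𝔼) → ℝ≥0∞)) :=
    measurable_one.indicator hgm
  have hF := (measurable_lintegral_face (betaMeasure d β) (κ := κ) Q x).lintegral_prod_right'
    (ν := Measure.pi fun _ : κ => betaMeasure d β)
  have h1 := (nullOnHyperplanes_volume (E := 𝔼)).ae_projRes_ne_zero hx (ι := ι) (by simpa)
  rw [← volume_pi] at h1
  have h2 := (nullOnHyperplanes_volume (E := 𝔼)).ae_linearIndependent_sub 0 (ι := ι)
      (by simpa using hι.le)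
  rw [← volume_pi] at h2
  have hV : Measurable fun δ : ι → 𝔼 => ‖projRes δ x‖⁻¹ • projRes δ x :=
    hresm.norm.inv.smul hresm
  have hV1 : ∀ᵐ δ : ι → 𝔼, ‖‖projRes δ x‖⁻¹ • projRes δ x‖ = 1 ∧
      ∀ i, inner ℝ (‖projRes δ x‖⁻¹ • projRes δ x) (δ i) = (0 : ℝ) := by
    filter_upwards [h1, h2] with δ h1 h2
    simp only [sub_zero] at h2
    refine ⟨norm_smul_inv_norm h1, fun i => ?_⟩
    rw [real_inner_smul_left, inner_projRes_eq_zero h2, mul_zero]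
  have hF1 : ∀ᵐ δ : ι → 𝔼, ∀ y : 𝔼, (∫⁻ Z, (coefSet Q x).indicator 1 δ *
      (negSet κ (projRes δ x) y).indicator 1 Z ∂(Measure.pi fun _ : κ => betaMeasure d β)) =
      (coefSet Q x).indicator 1 δ * (halfMass (β + ((d : ℝ) - 1) / 2)
        (inner ℝ (‖projRes δ x‖⁻¹ • projRes δ x) y) ^ Fintype.card κ) := by
    filter_upwards [h1] with δ h1 y
    rw [lintegral_const_mul' _ _ (by by_cases h : δ ∈ coefSet Q x <;> simp [h]),
      lintegral_negSet hβ ha κ h1]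
  have hVs : ∀ c : ℝ, 0 < c → ∀ δ : ι → 𝔼, ‖projRes (c • δ) x‖⁻¹ • projRes (c • δ) x =
      ‖projRes δ x‖⁻¹ • projRes δ x := fun c hc δ => by
    simp only [projRes_smul δ x hc.ne']
  rw [faceCoef, coefProb]
  have key := lintegral_betaMeasure_inner hβ ha hV hVs hV1 hg
    (fun c hc δ => coefSet_indicator_smul Q x hc δ)
    (φ := fun h => halfMass (β + ((d : ℝ) - 1) / 2) h ^ Fintype.card κ)
    ((measurable_halfMass (β + ((d : ℝ) - 1) / 2)).pow_const (Fintype.card κ)) hF hF1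
  exact key

end FaceStep

section Recursion

open scoped ENNReal

theorem measurableSet_faceEvent {E : Type*} [NormedAddCommGroup E] [InnerProductSpace ℝ E]
    [FiniteDimensional ℝ E] [MeasurableSpace E] [BorelSpace E] {τ : Type*} [Fintype τ]
    [DecidableEq τ] (P A : Finset τ) (x : E) : MeasurableSet {δ : τ → E | FaceEvent P A δ x} := by
  have h : Measurable fun δ : τ → E =>
      ((fun i : {i // i ∉ P ∨ i ∈ A} => δ i.1, x) : ({i // i ∉ P ∨ i ∈ A} → E) × E) :=
    (measurable_pi_lambda _ fun i => measurable_pi_apply _).prodMk measurable_const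
  have h1 := measurable_projRes.comp h
  have h2 := fun i => (measurable_projCoef i).comp h
  simp only [Function.comp_def] at h1 h2
  have : {δ : τ → E | FaceEvent P A δ x} =
      (⋂ i : {i // i ∉ P ∨ i ∈ A}, ⋂ _ : i.1 ∈ A,
        {δ | 0 < projCoef (fun i : {i // i ∉ P ∨ i ∈ A} => δ i.1) x i}) ∩
      ⋂ j : {j // ¬(j ∉ P ∨ j ∈ A)},
        {δ | inner ℝ (projRes (fun i : {i // i ∉ P ∨ i ∈ A} => δ i.1) x) (δ j.1) ≤ 0} := by
    ext δ
    simp only [FaceEvent, Set.mem_inter_iff, Set.mem_iInter, Set.mem_ofPred_eq]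
  rw [this]
  refine (MeasurableSet.iInter fun i => MeasurableSet.iInter fun _ =>
    measurableSet_lt measurable_const (h2 i)).inter (MeasurableSet.iInter fun j =>
    measurableSet_le (h1.inner (measurable_pi_apply j.1)) measurable_const)

variable {d : ℕ} {β : ℝ}

local notation "𝔼" => EuclideanSpace ℝ (Fin d)

theorem nullOnHyperplanes_betaMeasure (hβ : -1 < β) :
    NullOnHyperplanes (betaMeasure d β) := by
  obtain ⟨C, hC⟩ := betaMeasure_eq_withDensity (d := d) hβ
  rw [hC]
  exact nullOnHyperplanes_volume.mono (withDensity_absolutelyContinuous _ _)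

theorem lintegral_faceEvent (hβ : -1 < β) [IsProbabilityMeasure (betaMeasure d β)]
    (ha : 0 ≤ β + ((d : ℝ) - 1) / 2) {τ : Type*} [Fintype τ] [DecidableEq τ] (P A : Finset τ)
    (hA : Fintype.card {i // i ∉ P ∨ i ∈ A} < d) {x : 𝔼} (hx : x ≠ 0) :
    ∫⁻ y, ∫⁻ X, {δ : τ → 𝔼 | FaceEvent P A δ x}.indicator 1 (fun i => X i - y)
        ∂(Measure.pi fun _ : τ => betaMeasure d β) ∂(betaMeasure d β) =
      faceCoef (β + ((d : ℝ) - 1) / 2) (Fintype.card {i // i ∉ P ∨ i ∈ A} + 1)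
          (Fintype.card {j // ¬(j ∉ P ∨ j ∈ A)}) *
        coefProb (betaMeasure d β)
          (Finset.univ.filter fun i : {i // i ∉ P ∨ i ∈ A} => i.1 ∈ A) x := by
  rw [← lintegral_face hβ ha hA _ hx]
  refine lintegral_congr fun y => ?_
  have hmp := measurePreserving_piEquivPiSubtypeProd (fun _ : τ => betaMeasure d β)
    (fun i => i ∉ P ∨ i ∈ A)
  set Q := Finset.univ.filter fun i : {i // i ∉ P ∨ i ∈ A} => i.1 ∈ A with hQ
  have hm : Measurable fun q : ({i // i ∉ P ∨ i ∈ A} → 𝔼) × ({j // ¬(j ∉ P ∨ j ∈ A)} → 𝔼) =>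
      (coefSet Q x).indicator 1 (fun i => q.1 i - y) *
        (negSet {j // ¬(j ∉ P ∨ j ∈ A)} (projRes (fun i => q.1 i - y) x) y).indicator
          (1 : ({j // ¬(j ∉ P ∨ j ∈ A)} → 𝔼) → ℝ≥0∞) q.2 := by
    have h1 : Measurable
        fun q : ({i // i ∉ P ∨ i ∈ A} → 𝔼) × ({j // ¬(j ∉ P ∨ j ∈ A)} → 𝔼) =>
        ((((fun i => q.1 i - y), y), q.2) : (({i // i ∉ P ∨ i ∈ A} → 𝔼) × 𝔼) × _) := by
      refine ((measurable_pi_lambda _ fun i => ?_).prodMk measurable_const).prodMk measurable_snd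
      exact ((measurable_pi_apply i).comp measurable_fst).sub measurable_const
    have h2 := (measurable_lintegral_face (betaMeasure d β)
      (κ := {j // ¬(j ∉ P ∨ j ∈ A)}) Q x).comp h1
    simp only [Function.comp_def] at h2
    exact h2
  rw [← lintegral_prod (μ := Measure.pi fun _ : {i // i ∉ P ∨ i ∈ A} => betaMeasure d β)
    (ν := Measure.pi fun _ : {j // ¬(j ∉ P ∨ j ∈ A)} => betaMeasure d β) _ hm.aemeasurable,
    ← hmp.lintegral_comp hm]
  refine lintegral_congr fun X => ?_
  simp only [MeasurableEquiv.piEquivPiSubtypeProd, MeasurableEquiv.coe_mk,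
    Equiv.piEquivPiSubtypeProd_apply]
  have hiff : (fun i => X i - y) ∈ {δ : τ → 𝔼 | FaceEvent P A δ x} ↔
      (fun i : {i // i ∉ P ∨ i ∈ A} => X i.1 - y) ∈ coefSet Q x ∧
      (fun j : {j // ¬(j ∉ P ∨ j ∈ A)} => X j.1) ∈ negSet {j // ¬(j ∉ P ∨ j ∈ A)}
        (projRes (fun i : {i // i ∉ P ∨ i ∈ A} => X i.1 - y) x) y := by
    simp only [FaceEvent, coefSet, negSet, Set.mem_ofPred_eq, hQ, Finset.mem_filter,
      Finset.mem_univ, true_and]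
  by_cases h1 : (fun i : {i // i ∉ P ∨ i ∈ A} => X i.1 - y) ∈ coefSet Q x <;>
  by_cases h2 : (fun j : {j // ¬(j ∉ P ∨ j ∈ A)} => X j.1) ∈ negSet {j // ¬(j ∉ P ∨ j ∈ A)}
        (projRes (fun i : {i // i ∉ P ∨ i ∈ A} => X i.1 - y) x) y
  · rw [Set.indicator_of_mem (hiff.2 ⟨h1, h2⟩), Set.indicator_of_mem h1, Set.indicator_of_mem h2]
    simp
  · rw [Set.indicator_of_notMem fun h => h2 (hiff.1 h).2, Set.indicator_of_notMem h2, mul_zero]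
  · rw [Set.indicator_of_notMem fun h => h1 (hiff.1 h).1, Set.indicator_of_notMem h1, zero_mul]
  · rw [Set.indicator_of_notMem fun h => h1 (hiff.1 h).1, Set.indicator_of_notMem h1, zero_mul]

theorem projCoef_comp_equiv {E : Type*} [NormedAddCommGroup E] [InnerProductSpace ℝ E]
    {ι τ : Type*} [Fintype ι] [Fintype τ] (e : ι ≃ τ) {δ : τ → E} (hδ : LinearIndependent ℝ δ)
    (x : E) (i : ι) : projCoef (δ ∘ e) x i = projCoef δ x (e i) := by
  have h : (fun i => projCoef δ x (e i)) = projCoef (δ ∘ e) x := by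
    rw [eq_projCoef_iff (hδ.comp e e.injective)]
    intro j
    have := (eq_projCoef_iff hδ x (projCoef δ x)).1 rfl (e j)
    rwa [← e.sum_comp] at this
  exact (congrFun h i).symm

/-- The sum over all faces of the probabilities of being optimal is one. -/
theorem sum_lintegral_faceEvent (hβ : -1 < β) [IsProbabilityMeasure (betaMeasure d β)]
    {τ : Type*} [Fintype τ] [DecidableEq τ] (P : Finset τ) (hτ : Fintype.card τ ≤ d) (x : 𝔼) :
    ∑ A ∈ P.powerset, ∫⁻ y, ∫⁻ X,
        {δ : τ → 𝔼 | FaceEvent P A δ x}.indicator 1 (fun i => X i - y)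
        ∂(Measure.pi fun _ : τ => betaMeasure d β) ∂(betaMeasure d β) = 1 := by
  have hm : ∀ A, Measurable fun p : 𝔼 × (τ → 𝔼) =>
      {δ : τ → 𝔼 | FaceEvent P A δ x}.indicator (1 : (τ → 𝔼) → ℝ≥0∞) (fun i => p.2 i - p.1) := by
    intro A
    have h1 : Measurable fun p : 𝔼 × (τ → 𝔼) => fun i => p.2 i - p.1 :=
      measurable_pi_lambda _ fun i =>
        ((measurable_pi_apply i).comp measurable_snd).sub measurable_fst
    have h2 : Measurable ({δ : τ → 𝔼 | FaceEvent P A δ x}.indicator (1 : (τ → 𝔼) → ℝ≥0∞)) :=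
      measurable_one.indicator (measurableSet_faceEvent P A x)
    exact h2.comp h1
  rw [← lintegral_finsetSum _ fun A _ => (hm A).lintegral_prod_right']
  have key : ∀ y : 𝔼, ∑ A ∈ P.powerset, ∫⁻ X,
      {δ : τ → 𝔼 | FaceEvent P A δ x}.indicator (1 : (τ → 𝔼) → ℝ≥0∞) (fun i => X i - y)
        ∂(Measure.pi fun _ : τ => betaMeasure d β) = 1 := by
    intro y
    have hm' : ∀ A, Measurable fun X : τ → 𝔼 =>
        {δ : τ → 𝔼 | FaceEvent P A δ x}.indicator (1 : (τ → 𝔼) → ℝ≥0∞) (fun i => X i - y) :=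
      fun A => (measurable_one.indicator (measurableSet_faceEvent P A x)).comp
        (measurable_pi_lambda _ fun i => (measurable_pi_apply i).sub measurable_const)
    rw [← lintegral_finsetSum _ fun A _ => hm' A]
    have hae := (nullOnHyperplanes_betaMeasure (d := d) hβ).ae_linearIndependent_sub y
      (ι := τ) (by simpa)
    rw [lintegral_congr_ae (g := 1)]
    · simp
    filter_upwards [hae] with X hX
    obtain ⟨A, ⟨hA, hA2⟩, huniq⟩ := existsUnique_faceEvent P hX x
    rw [Finset.sum_eq_single A]
    · exact Set.indicator_of_mem (by exact hA2) _
    · intro B hB hBA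
      have hX' : (fun i => X i - y) ∉ {δ : τ → 𝔼 | FaceEvent P B δ x} :=
        fun h => hBA (huniq B ⟨hB, h⟩)
      rw [Set.indicator_of_notMem hX']
    · exact fun h => absurd hA h
  simp [key]

theorem lintegral_faceEvent_self (hβ : -1 < β) [IsProbabilityMeasure (betaMeasure d β)]
    {τ : Type*} [Fintype τ] [DecidableEq τ] (P : Finset τ) (hτ : Fintype.card τ ≤ d) (x : 𝔼) :
    ∫⁻ y, ∫⁻ X, {δ : τ → 𝔼 | FaceEvent P P δ x}.indicator 1 (fun i => X i - y)
        ∂(Measure.pi fun _ : τ => betaMeasure d β) ∂(betaMeasure d β) =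
      coefProb (betaMeasure d β) P x := by
  refine lintegral_congr fun y => lintegral_congr_ae ?_
  have hae := (nullOnHyperplanes_betaMeasure (d := d) hβ).ae_linearIndependent_sub y
      (ι := τ) (by simpa)
  filter_upwards [hae] with X hX
  have hall : ∀ i : τ, i ∉ P ∨ i ∈ P := fun i => (em _).symm
  have hiff : (fun i => X i - y) ∈ {δ : τ → 𝔼 | FaceEvent P P δ x} ↔
      (fun i => X i - y) ∈ coefSet P x := by
    simp only [FaceEvent, coefSet, Set.mem_ofPred_eq]
    have := projCoef_comp_equiv (Equiv.subtypeUnivEquiv hall) hX x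
    simp only [Function.comp_def, Equiv.subtypeUnivEquiv_apply] at this
    simp only [this]
    constructor
    · exact fun h i hi => h.1 ⟨i, hall i⟩ hi
    · exact fun h => ⟨fun i hi => h i.1 hi, fun j => absurd (hall j.1) j.2⟩
  by_cases h : (fun i => X i - y) ∈ coefSet P x
  · rw [Set.indicator_of_mem h, Set.indicator_of_mem (hiff.2 h)]
  · rw [Set.indicator_of_notMem h, Set.indicator_of_notMem (mt hiff.1 h)]

/-- The solution of the recursion satisfied by the probabilities `coefProb`; `f` is the number
of unconstrained coefficients and `p` the number of constrained ones. -/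
def coefRec (a : ℝ) (f p : ℕ) : ℝ :=
  1 - ∑ j : Fin p, (p.choose j : ℝ) *
    ((faceCoef a (f + j + 1) (p - j)).toReal * coefRec a f j)
termination_by p
decreasing_by exact j.2

theorem coefProb_le_one (μ : Measure 𝔼) [IsProbabilityMeasure μ] {ι : Type*} [Fintype ι]
    (Q : Finset ι) (x : 𝔼) : coefProb μ Q x ≤ 1 := by
  have h : ∀ δ : ι → 𝔼, (coefSet Q x).indicator (1 : (ι → 𝔼) → ℝ≥0∞) δ ≤ 1 := fun δ => by
    by_cases h : δ ∈ coefSet Q x <;> simp [h]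
  refine (lintegral_mono fun y => lintegral_mono fun X => h _).trans ?_
  simp

theorem sliceMean_le_one (a : ℝ) (s : ℕ) {φ : ℝ → ℝ≥0∞} (hφ : ∀ h, φ h ≤ 1) :
    sliceMean a s φ ≤ 1 := by
  refine (ENNReal.div_le_div_right (lintegral_mono fun h => ?_) _).trans ENNReal.div_self_le_one
  gcongr
  exact hφ h

theorem halfMass_le_one (a h : ℝ) : halfMass a h ≤ 1 :=
  sliceMean_le_one _ _ fun _ => Set.indicator_le_self' (by simp) _

theorem faceCoef_le_one (a : ℝ) (s m : ℕ) : faceCoef a s m ≤ 1 :=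
  sliceMean_le_one _ _ fun h => pow_le_one' (halfMass_le_one a h) m

theorem coefProb_toReal (hβ : -1 < β) [IsProbabilityMeasure (betaMeasure d β)]
    (ha : 0 ≤ β + ((d : ℝ) - 1) / 2) {x : 𝔼} (hx : x ≠ 0) (p : ℕ) :
    ∀ {τ : Type} [Fintype τ] [DecidableEq τ] (P : Finset τ) (f : ℕ), P.card = p →
      Fintype.card τ = f + p → f + p ≤ d →
      (coefProb (betaMeasure d β) P x).toReal = coefRec (β + ((d : ℝ) - 1) / 2) f p := by
  induction p using Nat.strong_induction_on with
  | _ p ih =>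
    intro τ _ _ P f hP hτ hd
    have hsum := sum_lintegral_faceEvent hβ P (by omega) x
    set a := β + ((d : ℝ) - 1) / 2 with hadef
    have hterm : ∀ A ∈ P.powerset, A ≠ P → (∫⁻ y, ∫⁻ X,
        {δ : τ → 𝔼 | FaceEvent P A δ x}.indicator (1 : (τ → 𝔼) → ℝ≥0∞) (fun i => X i - y)
        ∂(Measure.pi fun _ : τ => betaMeasure d β) ∂(betaMeasure d β)).toReal =
        (faceCoef a (f + A.card + 1) (p - A.card)).toReal * coefRec a f A.card := by
      intro A hA hAP
      rw [Finset.mem_powerset] at hA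
      have hlt : A.card < p := hP ▸ Finset.card_lt_card (hA.ssubset_of_ne hAP)
      have hc : Fintype.card {i // i ∉ P ∨ i ∈ A} = f + A.card := by
        rw [Fintype.card_subtype, Finset.filter_or, Finset.card_union_of_disjoint]
        · have h1 := Finset.card_compl P
          have h2 : Finset.univ.filter (fun i => i ∉ P) = Pᶜ := by ext; simp
          simp only [h2, Finset.filter_univ_mem]
          omega
        · rw [Finset.disjoint_filter]
          exact fun i _ h h' => h (hA h')
      have hc' : Fintype.card {j // ¬(j ∉ P ∨ j ∈ A)} = p - A.card := by
        rw [Fintype.card_subtype_compl, hc, hτ]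
        omega
      have hQ : (Finset.univ.filter fun i : {i // i ∉ P ∨ i ∈ A} => i.1 ∈ A).card = A.card := by
        refine Finset.card_bij (fun i _ => i.1) (by simp) (fun i _ j _ h => Subtype.ext h) ?_
        exact fun i hi => ⟨⟨i, Or.inr hi⟩, by simpa using hi, rfl⟩
      rw [lintegral_faceEvent hβ ha P A (by omega) hx, ENNReal.toReal_mul, hc, hc',
        ih A.card hlt _ f hQ hc (by omega)]
    have hle := fun A (hA : A ∈ P.powerset) =>
      (Finset.single_le_sum (f := fun A => ∫⁻ y, ∫⁻ X,
        {δ : τ → 𝔼 | FaceEvent P A δ x}.indicator (1 : (τ → 𝔼) → ℝ≥0∞) (fun i => X i - y)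
        ∂(Measure.pi fun _ : τ => betaMeasure d β) ∂(betaMeasure d β))
        (fun _ _ => zero_le) hA).trans hsum.le
    have hsum2 := congrArg ENNReal.toReal hsum
    rw [ENNReal.toReal_sum fun A hA => ((hle A hA).trans_lt ENNReal.one_lt_top).ne,
      ENNReal.toReal_one] at hsum2
    have hself := lintegral_faceEvent_self hβ P (by omega) x
    set c := (coefProb (betaMeasure d β) P x).toReal with hc
    set g : ℕ → ℝ := fun j => if j = p then c else
      (faceCoef a (f + j + 1) (p - j)).toReal * coefRec a f j with hg
    have h1 : ∑ A ∈ P.powerset, g A.card = 1 := by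
      rw [← hsum2]
      refine Finset.sum_congr rfl fun A hA => ?_
      by_cases hAP : A = P
      · rw [hAP, hself, hg, hP]
        simp [hc]
      · have : A.card ≠ p := by
          have := Finset.card_lt_card ((Finset.mem_powerset.1 hA).ssubset_of_ne hAP)
          omega
        simp only [hg, this, if_false]
        rw [hterm A hA hAP]
    rw [Finset.sum_powerset_apply_card, hP, Finset.sum_range_succ] at h1
    have h2 : ∑ j ∈ Finset.range p, p.choose j • g j = ∑ j : Fin p, (p.choose j : ℝ) *
        ((faceCoef a (f + j + 1) (p - j)).toReal * coefRec a f j) := by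
      rw [← Fin.sum_univ_eq_sum_range fun j => p.choose j • g j]
      refine Finset.sum_congr rfl fun j _ => ?_
      simp only [hg, j.2.ne, if_false, nsmul_eq_mul]
    have h3 : g p = c := by simp [hg]
    rw [h2, h3, Nat.choose_self, one_smul] at h1
    rw [coefRec]
    linarith

end Recursion

section Normalization

open scoped Pointwise

theorem integral_betaPDFReal {u v : ℝ} (hu : 0 < u) (hv : 0 < v) :
    ∫ t, ProbabilityTheory.betaPDFReal u v t = 1 := by
  have hnn : ∀ t, 0 ≤ ProbabilityTheory.betaPDFReal u v t := fun t => by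
    by_cases h : 0 < t ∧ t < 1
    · exact (ProbabilityTheory.betaPDFReal_pos h.1 h.2 hu hv).le
    · rw [ProbabilityTheory.betaPDFReal, if_neg h]
  rw [integral_eq_lintegral_of_nonneg_ae (Filter.Eventually.of_forall hnn)
    (ProbabilityTheory.measurable_betaPDFReal u v).aestronglyMeasurable]
  exact congrArg ENNReal.toReal (ProbabilityTheory.lintegral_betaPDF_eq_one hu hv)

theorem integral_radial_beta {u β : ℝ} (hu : 0 < u) (hβ : -1 < β) :
    ∫ y in Set.Ioi (0 : ℝ), y ^ (2 * u - 1) * (if y < 1 then (1 - y ^ 2) ^ β else 0) =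
      ProbabilityTheory.beta u (β + 1) / 2 := by
  have hB := ProbabilityTheory.beta_pos hu (by linarith : 0 < β + 1)
  have h1 := integral_comp_rpow_Ioi_of_pos (p := 2) two_pos
    (g := fun t => ProbabilityTheory.betaPDFReal u (β + 1) t)
  have h0 : ∫ t in Set.Ioi 0, ProbabilityTheory.betaPDFReal u (β + 1) t = 1 := by
    rw [setIntegral_eq_integral_of_forall_compl_eq_zero, integral_betaPDFReal hu (by linarith)]
    intro t ht
    rw [ProbabilityTheory.betaPDFReal, if_neg fun h => ht h.1]
  rw [h0] at h1
  · have h2 : ∀ y ∈ Set.Ioi (0 : ℝ), y ^ (2 * u - 1) * (if y < 1 then (1 - y ^ 2) ^ β else 0) =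
        ProbabilityTheory.beta u (β + 1) / 2 * ((2 * y ^ ((2 : ℝ) - 1)) •
          ProbabilityTheory.betaPDFReal u (β + 1) (y ^ (2 : ℝ))) := by
      intro y hy
      have hy : 0 < y := hy
      have h3 : y ^ (2 : ℝ) < 1 ↔ y < 1 := by
        rw [rpow_two]
        exact sq_lt_one_iff₀ hy.le
      rw [ProbabilityTheory.betaPDFReal]
      by_cases h : y < 1
      · rw [if_pos h, if_pos ⟨by positivity, h3.2 h⟩, ← rpow_mul hy.le, smul_eq_mul,
          show 2 * u - 1 = (2 * (u - 1)) + ((2 : ℝ) - 1) by ring, rpow_add hy, rpow_two]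
        simp only [add_sub_cancel_right]
        field_simp
      · rw [if_neg h, if_neg fun h' => h (h3.1 h'.2)]
        simp
    rw [setIntegral_congr_fun measurableSet_Ioi h2, integral_const_mul, h1, mul_one]

theorem integral_betaDensity {d : ℕ} (hd : 1 ≤ d) {β : ℝ} (hβ : -1 < β) :
    ∫ x, betaDensity d β x = 1 := by
  have : Nonempty (Fin d) := ⟨⟨0, hd⟩⟩
  have hd' : (0 : ℝ) < d / 2 := by positivity
  have h1 : ∀ y ∈ Set.Ioi (0 : ℝ), y ^ (d - 1) • (if y < 1 then (1 - y ^ 2) ^ β else 0) =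
      y ^ (2 * ((d : ℝ) / 2) - 1) * (if y < 1 then (1 - y ^ 2) ^ β else 0) := by
    intro y hy
    rw [show 2 * ((d : ℝ) / 2) - 1 = ((d - 1 : ℕ) : ℝ) by push_cast [hd]; ring, rpow_natCast,
      smul_eq_mul]
  have h2 := integral_fun_norm_addHaar (volume : Measure (EuclideanSpace ℝ (Fin d)))
    fun y : ℝ => if y < 1 then (1 - y ^ 2) ^ β else 0
  rw [finrank_euclideanSpace_fin, setIntegral_congr_fun measurableSet_Ioi h1,
    integral_radial_beta hd' hβ, measureReal_def, EuclideanSpace.volume_ball] at h2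
  simp only [betaDensity]
  rw [integral_const_mul, h2, ProbabilityTheory.beta]
  have hG1 := Gamma_pos_of_pos hd'
  have hG2 := Gamma_pos_of_pos (by linarith : 0 < β + 1)
  have hG3 := Gamma_pos_of_pos (by linarith : 0 < (d : ℝ) / 2 + β + 1)
  have hG4 := Gamma_add_one hd'.ne'
  rw [Fintype.card_fin, ENNReal.ofReal_one, one_pow, one_mul, ENNReal.toReal_ofReal (by positivity),
    hG4, ← add_assoc]
  have hpi : π ^ ((d : ℝ) / 2) = √π ^ d := by
    rw [sqrt_eq_rpow, ← rpow_natCast, ← rpow_mul pi_nonneg]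
    congr 1
    ring
  rw [hpi]
  have : (0 : ℝ) < √π := by positivity
  have : (0 : ℝ) < d := by exact_mod_cast hd
  simp only [nsmul_eq_mul, smul_eq_mul]
  rw [div_mul_div_comm, div_mul_eq_mul_div, div_mul_eq_mul_div]
  generalize Gamma ((d : ℝ) / 2 + β + 1) = G at *
  field_simp

theorem betaDensity_nonneg (d : ℕ) {β : ℝ} (hβ : -1 < β) (x : EuclideanSpace ℝ (Fin d)) :
    0 ≤ betaDensity d β x := by
  have hG2 := Gamma_pos_of_pos (by linarith : 0 < β + 1)
  have hG3 := Gamma_pos_of_pos (by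
    have : (0 : ℝ) ≤ d / 2 := by positivity
    linarith : 0 < (d : ℝ) / 2 + β + 1)
  rw [betaDensity]
  split_ifs with h
  · have : 0 ≤ 1 - ‖x‖ ^ 2 := by nlinarith [norm_nonneg x]
    positivity
  · simp

theorem integrable_betaDensity {d : ℕ} (hd : 1 ≤ d) {β : ℝ} (hβ : -1 < β) :
    Integrable (betaDensity d β) := by
  by_contra h
  have := integral_betaDensity hd hβ
  rw [integral_undef h] at this
  exact zero_ne_one this

theorem isProbabilityMeasure_betaMeasure {d : ℕ} (hd : 1 ≤ d) {β : ℝ} (hβ : -1 < β) :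
    IsProbabilityMeasure (betaMeasure d β) := by
  constructor
  rw [betaMeasure, if_neg hβ.ne', withDensity_apply _ MeasurableSet.univ, Measure.restrict_univ,
    ← ofReal_integral_eq_lintegral_ofReal (integrable_betaDensity hd hβ)
      (Filter.Eventually.of_forall (betaDensity_nonneg d hβ)), integral_betaDensity hd hβ,
    ENNReal.ofReal_one]

theorem isProbabilityMeasure_sphereUnif {d : ℕ} (hd : 1 ≤ d) :
    IsProbabilityMeasure (sphereUnif d) := by
  have : Nonempty (Fin d) := ⟨⟨0, hd⟩⟩
  constructor
  rw [sphereUnif, Measure.smul_apply, smul_eq_mul]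
  exact ENNReal.inv_mul_cancel (Measure.measure_univ_ne_zero.2 (Measure.toSphere_ne_zero _))
    (measure_ne_top _ _)

theorem isProbabilityMeasure_betaMeasure_neg_one {d : ℕ} (hd : 1 ≤ d) :
    IsProbabilityMeasure (betaMeasure d (-1)) := by
  have := isProbabilityMeasure_sphereUnif hd
  rw [betaMeasure, if_pos rfl]
  exact Measure.isProbabilityMeasure_map measurable_subtype_coe.aemeasurable

/-- The sphere law is null on linear hyperplanes. -/
theorem sphereUnif_hyperplane_zero {d : ℕ} {a : EuclideanSpace ℝ (Fin d)} (ha : a ≠ 0) :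
    sphereUnif d {u | inner ℝ a u.1 = (0 : ℝ)} = 0 := by
  have hm : MeasurableSet {u : Metric.sphere (0 : EuclideanSpace ℝ (Fin d)) 1 |
      inner ℝ a u.1 = (0 : ℝ)} :=
    measurableSet_eq_fun (by fun_prop) measurable_const
  rw [sphereUnif, Measure.smul_apply, Measure.toSphere_apply' _ hm]
  have : volume (Set.Ioo (0 : ℝ) 1 • (((↑) : Metric.sphere (0 : EuclideanSpace ℝ (Fin d)) 1 →
      EuclideanSpace ℝ (Fin d)) '' {u | inner ℝ a u.1 = (0 : ℝ)})) = 0 := by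
    refine measure_mono_null ?_ (nullOnHyperplanes_volume (E := EuclideanSpace ℝ (Fin d)) a 0 ha)
    rintro _ ⟨r, -, _, ⟨u, hu, rfl⟩, rfl⟩
    have hu : inner ℝ a u.1 = (0 : ℝ) := hu
    simp only [Set.mem_ofPred_eq, inner_smul_right, hu, mul_zero]
  simp [this]

end Normalization

section Geometry

variable {E : Type*} [NormedAddCommGroup E] [InnerProductSpace ℝ E]

theorem mem_convexHull_range_fin_succ {d : ℕ} (X : Fin (d + 1) → E) (y : E) :
    y ∈ convexHull ℝ (Set.range X) ↔ ∃ b : Fin d → ℝ, (∀ i, 0 ≤ b i) ∧ ∑ i, b i ≤ 1 ∧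
      y = X 0 + ∑ i, b i • (X i.succ - X 0) := by
  constructor
  · refine fun h => convexHull_min (t := {y | ∃ b : Fin d → ℝ, (∀ i, 0 ≤ b i) ∧ ∑ i, b i ≤ 1 ∧
      y = X 0 + ∑ i, b i • (X i.succ - X 0)}) ?_ ?_ h
    · rintro _ ⟨j, rfl⟩
      induction j using Fin.cases with
      | zero => exact ⟨0, by simp, by simp, by simp⟩
      | succ j =>
        refine ⟨Pi.single j 1, fun i => ?_, by simp, ?_⟩
        · by_cases h : i = j
          · subst h; simp
          · simp [h]
        · simp [Pi.single_apply, ite_smul]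
    · rintro _ ⟨b, hb, hb1, rfl⟩ _ ⟨c, hc, hc1, rfl⟩ s t hs ht hst
      refine ⟨fun i => s * b i + t * c i, fun i => ?_, ?_, ?_⟩
      · have := hb i; have := hc i; positivity
      · rw [Finset.sum_add_distrib, ← Finset.mul_sum, ← Finset.mul_sum]
        nlinarith
      · simp only [add_smul, mul_smul, Finset.sum_add_distrib, ← Finset.smul_sum, smul_add]
        rw [add_add_add_comm, ← add_smul, hst, one_smul]
  · rintro ⟨b, hb, hb1, rfl⟩
    have key : X 0 + ∑ i, b i • (X i.succ - X 0) =
        ∑ j, (Fin.cons (1 - ∑ i, b i) b : Fin (d + 1) → ℝ) j • X j := by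
      rw [Fin.sum_univ_succ]
      simp only [Fin.cons_zero, Fin.cons_succ, smul_sub, Finset.sum_sub_distrib, sub_smul,
        one_smul, ← Finset.sum_smul]
      abel
    rw [key]
    refine (convex_convexHull ℝ _).sum_mem (fun j _ => ?_) ?_ fun j _ =>
      subset_convexHull ℝ _ ⟨j, rfl⟩
    · induction j using Fin.cases with
      | zero => simpa using hb1
      | succ j => simpa using hb j
    · rw [Fin.sum_univ_succ]
      simp

theorem sum_projCoef_smul [FiniteDimensional ℝ E] {ι : Type*} [Fintype ι] {δ : ι → E}
    (hδ : LinearIndependent ℝ δ) (hc : Fintype.card ι = Module.finrank ℝ E) (x : E) :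
    ∑ i, projCoef δ x i • δ i = x := by
  have hspan : Submodule.span ℝ (Set.range δ) = ⊤ := hδ.span_eq_top_of_card_eq_finrank' hc
  have h : projRes δ x = 0 := by
    rw [← inner_self_eq_zero (𝕜 := ℝ)]
    have : ∀ y ∈ Submodule.span ℝ (Set.range δ), inner ℝ (projRes δ x) y = (0 : ℝ) := by
      intro y hy
      induction hy using Submodule.span_induction with
      | mem y hy =>
        obtain ⟨i, rfl⟩ := hy
        exact inner_projRes_eq_zero hδ x i
      | zero => simp
      | add y z _ _ hy hz => rw [inner_add_right, hy, hz, add_zero]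
      | smul c y _ hy => rw [inner_smul_right, hy, mul_zero]
    exact this _ (hspan ▸ Submodule.mem_top)
  rw [projRes, sub_eq_zero] at h
  exact h.symm

/-- The centroid of a face, in terms of edge vectors from the first vertex. -/
theorem centroid_eq {d k : ℕ} (hk : 1 ≤ k) (hkd : k ≤ d + 1) (X : Fin (d + 1) → E) :
    (k : ℝ)⁻¹ • ∑ i ∈ Finset.univ.filter (fun i : Fin (d + 1) => (i : ℕ) < k), X i =
      X 0 + ∑ i : Fin d, (if (i : ℕ) + 1 < k then (k : ℝ)⁻¹ else 0) • (X i.succ - X 0) := by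
  have hk0 : (k : ℝ) ≠ 0 := by positivity
  have hcard : (Finset.univ.filter (fun i : Fin (d + 1) => (i : ℕ) < k)).card = k := by
    rw [Fin.card_filter_val_lt]
    omega
  have h1 : ∑ i ∈ Finset.univ.filter (fun i : Fin (d + 1) => (i : ℕ) < k), X i =
      (k : ℝ) • X 0 +
        ∑ i ∈ Finset.univ.filter (fun i : Fin (d + 1) => (i : ℕ) < k), (X i - X 0) := by
    rw [Finset.sum_sub_distrib, Finset.sum_const, hcard, Nat.cast_smul_eq_nsmul]
    abel
  rw [h1, smul_add, inv_smul_smul₀ hk0, Finset.sum_filter, Fin.sum_univ_succ]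
  congr 1
  simp only [sub_self, ite_self, zero_add, Fin.val_succ, Finset.smul_sum, ite_smul, zero_smul,
    smul_ite, smul_zero]

theorem sum_centroid_coef {d k : ℕ} (hk : 1 ≤ k) :
    ∑ i : Fin d, (if (i : ℕ) + 1 < k then (k : ℝ)⁻¹ else 0) < 1 := by
  have hk0 : (0 : ℝ) < k := by positivity
  rw [← Finset.sum_filter, Finset.sum_const, nsmul_eq_mul, ← div_eq_mul_inv, div_lt_one hk0]
  have : (Finset.univ.filter fun i : Fin d => (i : ℕ) + 1 < k) =
      Finset.univ.filter fun i : Fin d => (i : ℕ) < k - 1 := by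
    ext i; simp; omega
  rw [this, Fin.card_filter_val_lt]
  have : min d (k - 1) < k := by omega
  exact_mod_cast this

/-- The coordinates, with respect to the edges from the first vertex, that describe the tangent
cone at the face spanned by the first `k` vertices. -/
def coneCoords (d k : ℕ) : Finset (Fin d) := Finset.univ.filter fun i => k ≤ (i : ℕ) + 1

theorem exists_mem_convexHull_iff [FiniteDimensional ℝ E] {d k : ℕ} (hk : 1 ≤ k)
    (hkd : k ≤ d + 1) {X : Fin (d + 1) → E}
    (hX : LinearIndependent ℝ fun i : Fin d => X i.succ - X 0) (hd : Module.finrank ℝ E = d)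
    (u : E) :
    (∃ ε : ℝ, 0 < ε ∧
      (k : ℝ)⁻¹ • ∑ i ∈ Finset.univ.filter (fun i : Fin (d + 1) => (i : ℕ) < k), X i + ε • u ∈
        convexHull ℝ (Set.range X)) ↔
      ∀ i ∈ coneCoords d k, 0 ≤ projCoef (fun i : Fin d => X i.succ - X 0) u i := by
  set δ : Fin d → E := fun i => X i.succ - X 0 with hδ
  set c : Fin d → ℝ := fun i => if (i : ℕ) + 1 < k then (k : ℝ)⁻¹ else 0 with hc
  have hk0 : (0 : ℝ) < k := by positivity
  have hu := sum_projCoef_smul hX (by simp [hd]) u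
  set a := projCoef δ u with ha
  have hpt : ∀ ε : ℝ,
      (k : ℝ)⁻¹ • ∑ i ∈ Finset.univ.filter (fun i : Fin (d + 1) => (i : ℕ) < k), X i + ε • u =
        X 0 + ∑ i, (c i + ε * a i) • δ i := by
    intro ε
    rw [centroid_eq hk hkd]
    conv_lhs => rw [← hu]
    simp only [add_smul, Finset.sum_add_distrib, mul_smul, ← Finset.smul_sum]
    rw [add_assoc]
  have hmem : ∀ ε : ℝ, (X 0 + ∑ i, (c i + ε * a i) • δ i ∈ convexHull ℝ (Set.range X)) ↔
      (∀ i, 0 ≤ c i + ε * a i) ∧ ∑ i, (c i + ε * a i) ≤ 1 := by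
    intro ε
    rw [mem_convexHull_range_fin_succ]
    constructor
    · rintro ⟨b, hb, hb1, h⟩
      have h := add_left_cancel h
      have hb' : (fun i => c i + ε * a i) = b := by
        have h2 : ∑ i, (c i + ε * a i - b i) • δ i = 0 := by
          simp only [sub_smul, Finset.sum_sub_distrib]
          exact sub_eq_zero.2 h
        funext i
        exact sub_eq_zero.1 (Fintype.linearIndependent_iff.1 hX _ h2 i)
      rw [← hb'] at hb hb1
      exact ⟨hb, hb1⟩
    · exact fun h => ⟨_, h.1, h.2, rfl⟩
  simp only [hpt, hmem]
  have hc0 : ∀ i ∈ coneCoords d k, c i = 0 := by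
    intro i hi
    simp only [coneCoords, Finset.mem_filter, Finset.mem_univ, true_and] at hi
    simp only [hc]
    rw [if_neg (by omega)]
  have hc1 : ∀ i ∉ coneCoords d k, 0 < c i := by
    intro i hi
    simp only [coneCoords, Finset.mem_filter, Finset.mem_univ, true_and, not_le] at hi
    simp only [hc]
    rw [if_pos hi]
    positivity
  constructor
  · rintro ⟨ε, hε, h, -⟩ i hi
    have := h i
    rw [hc0 i hi, zero_add] at this
    exact nonneg_of_mul_nonneg_right this hε
  · intro h
    have h1 : ∀ i, ∀ᶠ ε in nhdsWithin (0 : ℝ) (Set.Ioi 0), 0 ≤ c i + ε * a i := by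
      intro i
      by_cases hi : i ∈ coneCoords d k
      · filter_upwards [self_mem_nhdsWithin] with ε hε
        rw [hc0 i hi, zero_add]
        exact mul_nonneg (le_of_lt hε) (h i hi)
      · have : Filter.Tendsto (fun ε : ℝ => c i + ε * a i) (nhds 0) (nhds (c i + 0 * a i)) :=
          Continuous.tendsto (by fun_prop) 0
        rw [zero_mul, add_zero] at this
        exact nhdsWithin_le_nhds ((this.eventually_const_lt (hc1 i hi)).mono fun _ h => h.le)
    have h2 : ∀ᶠ ε in nhdsWithin (0 : ℝ) (Set.Ioi 0), ∑ i, (c i + ε * a i) ≤ 1 := by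
      have : Filter.Tendsto (fun ε : ℝ => ∑ i, (c i + ε * a i)) (nhds 0)
          (nhds (∑ i, (c i + 0 * a i))) := Continuous.tendsto (by fun_prop) 0
      simp only [zero_mul, add_zero] at this
      exact nhdsWithin_le_nhds
        ((this.eventually_lt_const (sum_centroid_coef hk)).mono fun _ h => h.le)
    have h0 : ∀ᶠ ε in nhdsWithin (0 : ℝ) (Set.Ioi 0), 0 < ε := self_mem_nhdsWithin
    obtain ⟨ε, hε, h1, h2⟩ := (h0.and ((Filter.eventually_all.2 h1).and h2)).exists
    exact ⟨ε, hε, h1, h2⟩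

theorem exists_projCoef_eq_inner {ι : Type*} [Fintype ι] {δ : ι → E}
    (hδ : LinearIndependent ℝ δ) (i : ι) :
    ∃ a : E, a ≠ 0 ∧ ∀ x, projCoef δ x i = inner ℝ a x := by
  classical
  have h : ∀ x, projCoef δ x i = inner ℝ (((Matrix.gram ℝ δ).det)⁻¹ •
      ∑ j, (Matrix.gram ℝ δ).adjugate i j • δ j) x := by
    intro x
    rw [projCoef_eq_inv_det, real_inner_smul_left, sum_inner]
    simp only [real_inner_smul_left]
    rfl
  refine ⟨_, fun h0 => ?_, h⟩
  have h1 := h (δ i)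
  rw [h0, inner_zero_left] at h1
  have h2 : Pi.single i 1 = projCoef δ (δ i) := by
    rw [eq_projCoef_iff hδ]
    simp [Pi.single_apply, ite_smul]
  rw [← h2, Pi.single_eq_same] at h1
  exact one_ne_zero h1

end Geometry

section AngleFormula

open scoped ENNReal

variable {d : ℕ}

local notation "𝔼" => EuclideanSpace ℝ (Fin d)

/-- The pairs of a family of points and a direction such that the coefficients of the direction
with index in `Q` with respect to the edges from the first point are positive. -/
def edgeSet (Q : Finset (Fin d)) : Set ((Fin (d + 1) → 𝔼) × Metric.sphere (0 : 𝔼) 1) :=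
  {p | (fun i : Fin d => p.1 i.succ - p.1 0) ∈ coefSet Q p.2.1}

theorem measurableSet_edgeSet (Q : Finset (Fin d)) : MeasurableSet (edgeSet Q) := by
  have h : Measurable fun p : (Fin (d + 1) → 𝔼) × Metric.sphere (0 : 𝔼) 1 =>
      ((fun i : Fin d => p.1 i.succ - p.1 0, p.2.1) : (Fin d → 𝔼) × 𝔼) := by
    refine (measurable_pi_lambda _ fun i => ?_).prodMk (measurable_subtype_coe.comp measurable_snd)
    exact ((measurable_pi_apply _).comp measurable_fst).sub
      ((measurable_pi_apply _).comp measurable_fst)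
  exact h (measurableSet_coefSet Q)

theorem ae_linearIndependent_edges {μ : Measure 𝔼} [IsProbabilityMeasure μ]
    (hμ : NullOnHyperplanes μ) :
    ∀ᵐ X ∂Measure.pi fun _ : Fin (d + 1) => μ,
      LinearIndependent ℝ fun i : Fin d => X i.succ - X 0 := by
  have hmp := measurePreserving_piFinSuccAbove (fun _ : Fin (d + 1) => μ) 0
  have hS : MeasurableSet {p : 𝔼 × (Fin d → 𝔼) | LinearIndependent ℝ fun i => p.2 i - p.1} := by
    refine IsOpen.measurableSet (isOpen_setOfPred_linearIndependent.preimage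
      (f := fun p : 𝔼 × (Fin d → 𝔼) => fun i => p.2 i - p.1) ?_)
    fun_prop
  have h : ∀ᵐ p ∂μ.prod (Measure.pi fun _ : Fin d => μ),
      LinearIndependent ℝ fun i => p.2 i - p.1 := by
    rw [Measure.ae_prod_iff_ae_ae hS]
    exact Filter.Eventually.of_forall fun y => hμ.ae_linearIndependent_sub y (by simp)
  exact hmp.quasiMeasurePreserving.ae h

theorem internalAngle_eq_coefSet {k : ℕ} (hk : 1 ≤ k) (hkd : k ≤ d + 1)
    {X : Fin (d + 1) → 𝔼} (hX : LinearIndependent ℝ fun i : Fin d => X i.succ - X 0) :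
    internalAngle
      ((k : ℝ)⁻¹ • ∑ i ∈ Finset.univ.filter (fun i : Fin (d + 1) => (i : ℕ) < k), X i)
      (convexHull ℝ (Set.range X)) =
    (∫⁻ u, (coefSet (coneCoords d k) u.1).indicator (1 : (Fin d → 𝔼) → ℝ≥0∞)
      (fun i : Fin d => X i.succ - X 0) ∂sphereUnif d).toReal := by
  set δ : Fin d → 𝔼 := fun i => X i.succ - X 0 with hδ
  rw [internalAngle]
  simp only [exists_mem_convexHull_iff hk hkd hX (by simp)]
  have hm : MeasurableSet {u : Metric.sphere (0 : 𝔼) 1 | δ ∈ coefSet (coneCoords d k) u.1} :=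
    (measurable_prodMk_left (x := X)) (measurableSet_edgeSet (coneCoords d k))
  have h1 : ∀ u : Metric.sphere (0 : 𝔼) 1,
      (coefSet (coneCoords d k) u.1).indicator (1 : (Fin d → 𝔼) → ℝ≥0∞) δ =
      {u : Metric.sphere (0 : 𝔼) 1 | δ ∈ coefSet (coneCoords d k) u.1}.indicator 1 u := by
    intro u
    by_cases h : δ ∈ coefSet (coneCoords d k) u.1
    · rw [Set.indicator_of_mem h, Set.indicator_of_mem (by exact h)]
      rfl
    · rw [Set.indicator_of_notMem h, Set.indicator_of_notMem (by exact h)]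
  simp only [h1]
  rw [lintegral_indicator_one hm]
  congr 1
  refine measure_congr ?_
  have hne : ∀ i : Fin d, ∀ᵐ u ∂sphereUnif d, projCoef δ u.1 i ≠ 0 := by
    intro i
    obtain ⟨a, ha, h⟩ := exists_projCoef_eq_inner hX i
    simp only [h]
    rw [ae_iff]
    simp only [not_not]
    exact sphereUnif_hyperplane_zero ha
  filter_upwards [ae_all_iff.2 hne] with u hu
  refine propext (forall₂_congr fun i _ => ?_)
  exact ⟨fun h => lt_of_le_of_ne h (hu i).symm, le_of_lt⟩

theorem measurable_edgeSet_indicator (Q : Finset (Fin d)) :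
    Measurable fun p : (Fin (d + 1) → 𝔼) × Metric.sphere (0 : 𝔼) 1 =>
      (coefSet Q p.2.1).indicator (1 : (Fin d → 𝔼) → ℝ≥0∞)
        (fun i : Fin d => p.1 i.succ - p.1 0) :=
  (measurable_one (α := ℝ≥0∞)).indicator (measurableSet_edgeSet (d := d) Q)

theorem measure_edgeSet (hd : 1 ≤ d) (μ : Measure 𝔼) [IsProbabilityMeasure μ]
    (Q : Finset (Fin d)) :
    ((Measure.pi fun _ : Fin (d + 1) => μ).prod (sphereUnif d)) (edgeSet Q) =
      ∫⁻ u, coefProb μ Q u.1 ∂sphereUnif d := by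
  have := isProbabilityMeasure_sphereUnif hd
  have hm := measurable_edgeSet_indicator Q
  rw [← lintegral_indicator_one (measurableSet_edgeSet Q)]
  change ∫⁻ p : (Fin (d + 1) → 𝔼) × Metric.sphere (0 : 𝔼) 1, (coefSet Q p.2.1).indicator
    (1 : (Fin d → 𝔼) → ℝ≥0∞) (fun i : Fin d => p.1 i.succ - p.1 0) ∂_ = _
  rw [lintegral_prod_symm _ hm.aemeasurable]
  refine lintegral_congr fun u => ?_
  have hm' : Measurable fun q : 𝔼 × (Fin d → 𝔼) =>
      (coefSet Q u.1).indicator (1 : (Fin d → 𝔼) → ℝ≥0∞) (fun i => q.2 i - q.1) := by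
    have h1 : Measurable fun q : 𝔼 × (Fin d → 𝔼) => (fun i => q.2 i - q.1 : Fin d → 𝔼) :=
      measurable_pi_lambda _ fun i =>
        ((measurable_pi_apply i).comp measurable_snd).sub measurable_fst
    exact (measurable_one.indicator (measurableSet_coefSet_left Q u.1)).comp h1
  have hmp := measurePreserving_piFinSuccAbove (fun _ : Fin (d + 1) => μ) 0
  have h2 := hmp.lintegral_comp hm'
  rw [lintegral_prod _ hm'.aemeasurable] at h2
  exact h2

theorem integral_internalAngle (hd : 1 ≤ d) {μ : Measure 𝔼} [IsProbabilityMeasure μ]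
    (hμ : NullOnHyperplanes μ) {k : ℕ} (hk : 1 ≤ k) (hkd : k ≤ d + 1) :
    ∫ X : Fin (d + 1) → 𝔼, internalAngle
      ((k : ℝ)⁻¹ • ∑ i ∈ Finset.univ.filter (fun i : Fin (d + 1) => (i : ℕ) < k), X i)
      (convexHull ℝ (Set.range X)) ∂(Measure.pi fun _ => μ) =
    (((Measure.pi fun _ : Fin (d + 1) => μ).prod (sphereUnif d))
      (edgeSet (coneCoords d k))).toReal := by
  have := isProbabilityMeasure_sphereUnif hd
  set Q := coneCoords d k with hQ
  have hm := measurable_edgeSet_indicator Q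
  have hle : ∀ p : (Fin (d + 1) → 𝔼) × Metric.sphere (0 : 𝔼) 1,
      (coefSet Q p.2.1).indicator (1 : (Fin d → 𝔼) → ℝ≥0∞)
        (fun i : Fin d => p.1 i.succ - p.1 0) ≤ 1 :=
    fun p => Set.indicator_le_self' (by simp) _
  rw [integral_congr_ae ((ae_linearIndependent_edges hμ).mono fun X hX =>
    internalAngle_eq_coefSet hk hkd hX), integral_toReal (hm.lintegral_prod_right').aemeasurable
    (Filter.Eventually.of_forall fun X => ?_)]
  · rw [← lintegral_indicator_one (measurableSet_edgeSet Q), ← lintegral_prod _ hm.aemeasurable]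
    rfl
  · refine (lintegral_mono fun u => hle (X, u)).trans_lt ?_
    simp

theorem card_coneCoords {k : ℕ} (hk : 1 ≤ k) (hkd : k ≤ d + 1) :
    (coneCoords d k).card = d + 1 - k := by
  have : (coneCoords d k)ᶜ = Finset.univ.filter fun i : Fin d => (i : ℕ) < k - 1 := by
    ext i; simp [coneCoords]; omega
  have h := Finset.card_compl (coneCoords d k)
  rw [this, Fin.card_filter_val_lt, Fintype.card_fin] at h
  have := Finset.card_le_univ (coneCoords d k)
  rw [Fintype.card_fin] at this
  omega

theorem measure_edgeSet_betaMeasure (hd : 1 ≤ d) {β : ℝ} (hβ : -1 < β)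
    (ha : 0 ≤ β + ((d : ℝ) - 1) / 2) {k : ℕ} (hk : 1 ≤ k) (hkd : k ≤ d + 1) :
    (((Measure.pi fun _ : Fin (d + 1) => betaMeasure d β).prod (sphereUnif d))
      (edgeSet (coneCoords d k))).toReal =
      coefRec (β + ((d : ℝ) - 1) / 2) (k - 1) (d + 1 - k) := by
  have := isProbabilityMeasure_betaMeasure hd hβ
  have := isProbabilityMeasure_sphereUnif hd
  have h := fun u : Metric.sphere (0 : 𝔼) 1 => coefProb_toReal hβ ha
    (ne_zero_of_mem_unit_sphere u) (d + 1 - k) (coneCoords d k) (k - 1) (card_coneCoords hk hkd)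
    (by simp; omega) (by omega)
  have h2 : ∀ u : Metric.sphere (0 : 𝔼) 1, coefProb (betaMeasure d β) (coneCoords d k) u.1 =
      ENNReal.ofReal (coefRec (β + ((d : ℝ) - 1) / 2) (k - 1) (d + 1 - k)) := fun u => by
    rw [← h u, ENNReal.ofReal_toReal ((coefProb_le_one _ _ _).trans_lt ENNReal.one_lt_top).ne]
  obtain ⟨u⟩ : Nonempty (Metric.sphere (0 : 𝔼) 1) := (sphereUnif d).nonempty_of_neZero
  simp only [measure_edgeSet hd, h2, lintegral_const, measure_univ, mul_one]
  exact ENNReal.toReal_ofReal (h u ▸ ENNReal.toReal_nonneg)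

/-- The expected internal angle for `β > -1`. -/
theorem J_eq_coefRec (hd : 1 ≤ d) {β : ℝ} (hβ : -1 < β) (ha : 0 ≤ β + ((d : ℝ) - 1) / 2)
    {k : ℕ} (hk : 1 ≤ k) (hkd : k ≤ d + 1) :
    J (d + 1) k β = coefRec (β + ((d : ℝ) - 1) / 2) (k - 1) (d + 1 - k) := by
  have := isProbabilityMeasure_betaMeasure hd hβ
  rw [← measure_edgeSet_betaMeasure hd hβ ha hk hkd]
  exact integral_internalAngle hd (nullOnHyperplanes_betaMeasure (d := d) hβ) hk hkd

end AngleFormula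

section Rationality

open scoped ENNReal

/-- The weighted moments of `h` against `(1 - h²)^b`. -/
def sliceMoment (b : ℝ) (j : ℕ) : ℝ := ∫ h in (-1 : ℝ)..1, h ^ j * (1 - h ^ 2) ^ b

theorem continuous_sliceWeight {b : ℝ} (hb : 0 ≤ b) : Continuous fun h : ℝ => (1 - h ^ 2) ^ b :=
  Continuous.rpow_const (by fun_prop) fun _ => Or.inr hb

theorem integral_deriv_sliceWeight {b : ℝ} (hb : 0 ≤ b) (j : ℕ) :
    ∫ h in (-1 : ℝ)..1, ((j : ℝ) * h ^ (j - 1) * (1 - h ^ 2) ^ (b + 1) +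
      h ^ j * (-(2 * (b + 1)) * (h * (1 - h ^ 2) ^ b))) = 0 := by
  have hw := continuous_sliceWeight hb
  have hw' := continuous_sliceWeight (b := b + 1) (by linarith)
  rw [intervalIntegral.integral_eq_sub_of_hasDerivAt
    (f := fun h : ℝ => h ^ j * (1 - h ^ 2) ^ (b + 1))]
  · have : b + 1 ≠ 0 := by linarith
    simp [this]
  · intro x _
    have h1 : HasDerivAt (fun h : ℝ => 1 - h ^ 2) (-(2 * x)) x := by
      simpa using (hasDerivAt_pow 2 x).const_sub 1
    have h2 := h1.rpow_const (p := b + 1) (Or.inr (by linarith))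
    rw [add_sub_cancel_right] at h2
    refine ((hasDerivAt_pow j x).mul h2).congr_deriv ?_
    ring
  · refine Continuous.intervalIntegrable ?_ _ _
    fun_prop

theorem sliceMoment_one {b : ℝ} (hb : 0 ≤ b) : sliceMoment b 1 = 0 := by
  have h := integral_deriv_sliceWeight hb 0
  simp only [Nat.cast_zero, zero_mul, zero_add, pow_zero, one_mul,
    intervalIntegral.integral_const_mul] at h
  have : b + 1 ≠ 0 := by linarith
  simpa [sliceMoment, this] using h

theorem sliceMoment_add_two {b : ℝ} (hb : 0 ≤ b) (j : ℕ) :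
    sliceMoment b (j + 2) = (j + 1) / (j + 2 * b + 3) * sliceMoment b j := by
  have hw := continuous_sliceWeight hb
  have h := integral_deriv_sliceWeight hb (j + 1)
  have h2 : ∫ h in (-1 : ℝ)..1, (((j + 1 : ℕ) : ℝ) * h ^ (j + 1 - 1) * (1 - h ^ 2) ^ (b + 1) +
      h ^ (j + 1) * (-(2 * (b + 1)) * (h * (1 - h ^ 2) ^ b))) =
      ∫ h in (-1 : ℝ)..1, (((j : ℝ) + 1) * (h ^ j * (1 - h ^ 2) ^ b) -
        ((j : ℝ) + 2 * b + 3) * (h ^ (j + 2) * (1 - h ^ 2) ^ b)) := by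
    refine intervalIntegral.integral_congr fun x hx => ?_
    rw [Set.uIcc_of_le (by norm_num)] at hx
    have h0 : 0 ≤ 1 - x ^ 2 := by nlinarith [hx.1, hx.2]
    simp only [rpow_add_one' h0 (show b + 1 ≠ 0 by linarith), Nat.cast_add, Nat.cast_one,
      Nat.add_sub_cancel]
    ring
  rw [h2, intervalIntegral.integral_sub, intervalIntegral.integral_const_mul,
    intervalIntegral.integral_const_mul] at h
  · have h3 : (j : ℝ) + 2 * b + 3 ≠ 0 := by positivity
    unfold sliceMoment
    field_simp
    linarith
  all_goals
    refine Continuous.intervalIntegrable ?_ _ _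
    fun_prop

theorem sliceMoment_rat {b : ℚ} (hb : 0 ≤ b) (j : ℕ) :
    ∃ q : ℚ, sliceMoment b j = q * sliceMoment b 0 := by
  have hb' : (0 : ℝ) ≤ b := by exact_mod_cast hb
  induction j using Nat.twoStepInduction with
  | zero => exact ⟨1, by simp⟩
  | one => exact ⟨0, by simp [sliceMoment_one hb']⟩
  | more j ih _ =>
    obtain ⟨q, hq⟩ := ih
    refine ⟨(j + 1) / (j + 2 * b + 3) * q, ?_⟩
    rw [sliceMoment_add_two hb', hq]
    push_cast
    ring

theorem integral_polynomial_sliceWeight_rat {b : ℚ} (hb : 0 ≤ b) (P : Polynomial ℚ) :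
    ∃ q : ℚ, ∫ h in (-1 : ℝ)..1, P.aeval h * (1 - h ^ 2) ^ (b : ℝ) = q * sliceMoment b 0 := by
  have hw := continuous_sliceWeight (b := b) (by exact_mod_cast hb)
  induction P using Polynomial.induction_on' with
  | add p p' h h' =>
    obtain ⟨q, hq⟩ := h
    obtain ⟨q', hq'⟩ := h'
    refine ⟨q + q', ?_⟩
    simp only [map_add, add_mul]
    rw [intervalIntegral.integral_add, hq, hq']
    · push_cast; ring
    all_goals
      refine Continuous.intervalIntegrable ?_ _ _
      have := fun p : Polynomial ℚ => p.continuous_aeval (A := ℝ)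
      fun_prop
  | monomial j c =>
    obtain ⟨q, hq⟩ := sliceMoment_rat hb j
    refine ⟨c * q, ?_⟩
    simp only [Polynomial.aeval_monomial, mul_assoc]
    rw [intervalIntegral.integral_const_mul]
    change _ * sliceMoment b j = _
    rw [hq]
    simp [mul_assoc]

theorem toReal_sliceInt {a : ℝ} {s : ℕ} {φ : ℝ → ℝ≥0∞} (hφ : Measurable φ)
    (hφt : ∀ h, φ h ≠ ⊤) :
    (sliceInt a s φ).toReal = ∫ h in (-1 : ℝ)..1, (φ h).toReal * (1 - h ^ 2) ^ sliceExp a s := by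
  rw [intervalIntegral.integral_of_le (by norm_num), integral_Ioc_eq_integral_Ioo,
    integral_eq_lintegral_of_nonneg_ae]
  · rw [sliceInt]
    congr 1
    refine setLIntegral_congr_fun measurableSet_Ioo fun x hx => ?_
    have h1 : 0 < 1 - x ^ 2 := by nlinarith [hx.1, hx.2]
    simp only [ENNReal.ofReal_mul ENNReal.toReal_nonneg, ENNReal.ofReal_toReal (hφt x)]
  · filter_upwards [ae_restrict_mem measurableSet_Ioo] with x hx
    have h1 : 0 < 1 - x ^ 2 := by nlinarith [hx.1, hx.2]
    simp only [Pi.zero_apply]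
    positivity
  · exact (hφ.ennreal_toReal.mul (by fun_prop)).aestronglyMeasurable

theorem sliceMoment_zero_pos (a : ℝ) {s : ℕ} (ha : 0 ≤ a) (hs : 1 ≤ s) :
    0 < sliceMoment (sliceExp a s) 0 := by
  have h := toReal_sliceInt (a := a) (s := s) (φ := 1) measurable_one (by simp)
  have h2 := ENNReal.toReal_pos (sliceInt_one_ne_zero a s) (sliceInt_one_ne_top ha hs)
  rw [h] at h2
  simpa [sliceMoment] using h2

theorem toReal_sliceMean {a : ℝ} {s : ℕ} {φ : ℝ → ℝ≥0∞} (hφ : Measurable φ)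
    (hφt : ∀ h, φ h ≠ ⊤) :
    (sliceMean a s φ).toReal =
      (∫ h in (-1 : ℝ)..1, (φ h).toReal * (1 - h ^ 2) ^ sliceExp a s) /
        sliceMoment (sliceExp a s) 0 := by
  rw [sliceMean, ENNReal.toReal_div, toReal_sliceInt hφ hφt, toReal_sliceInt measurable_one (by simp)]
  simp [sliceMoment]

theorem exists_derivative_eq (p : Polynomial ℚ) : ∃ q : Polynomial ℚ, q.derivative = p := by
  induction p using Polynomial.induction_on' with
  | add p p' h h' =>
    obtain ⟨q, rfl⟩ := h
    obtain ⟨q', rfl⟩ := h'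
    exact ⟨q + q', by simp⟩
  | monomial j c =>
    refine ⟨Polynomial.monomial (j + 1) (c / (j + 1)), ?_⟩
    rw [Polynomial.derivative_monomial]
    have : (j : ℚ) + 1 ≠ 0 := by positivity
    simp [this]

/-- For integral `a` the half-space masses are given by a rational polynomial. -/
theorem halfMass_polynomial (a : ℕ) : ∃ P : Polynomial ℚ, ∀ h ∈ Set.Icc (-1 : ℝ) 1,
    (halfMass a h).toReal = P.aeval h := by
  obtain ⟨Q, hQ⟩ := exists_derivative_eq ((1 - Polynomial.X ^ 2) ^ a)
  have hint : ∀ x y : ℝ, ∫ h in x..y, (1 - h ^ 2) ^ (a : ℝ) = Q.aeval y - Q.aeval x := by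
    intro x y
    rw [intervalIntegral.integral_eq_sub_of_hasDerivAt (f := fun h => Q.aeval h)]
    · intro h _
      have := Q.hasDerivAt_aeval h
      rw [hQ] at this
      simpa using this
    · exact (continuous_sliceWeight (by positivity)).intervalIntegrable _ _
  have hexp : sliceExp (a : ℝ) 1 = a := by simp [sliceExp]
  refine ⟨Polynomial.C ((Q.eval 1 - Q.eval (-1))⁻¹) * (Q - Polynomial.C (Q.eval (-1))),
    fun h hh => ?_⟩
  have e : ∀ q : ℚ, Polynomial.aeval (q : ℝ) Q = ((Q.eval q : ℚ) : ℝ) := fun q => by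
    rw [Polynomial.aeval_def, Polynomial.eval₂_eq_eval_map]
    exact (Polynomial.eval_map_apply (f := algebraMap ℚ ℝ) q)
  have e1 : Polynomial.aeval (1 : ℝ) Q = ((Q.eval 1 : ℚ) : ℝ) := by simpa using e 1
  have e2 : Polynomial.aeval (-1 : ℝ) Q = ((Q.eval (-1) : ℚ) : ℝ) := by simpa using e (-1)
  rw [halfMass, toReal_sliceMean (measurable_one.indicator measurableSet_Iic)]
  · have h1 : ∫ x in (-1 : ℝ)..1, ((Set.Iic h).indicator (1 : ℝ → ℝ≥0∞) x).toReal *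
        (1 - x ^ 2) ^ (a : ℝ) = ∫ x in (-1 : ℝ)..h, (1 - x ^ 2) ^ (a : ℝ) := by
      rw [← intervalIntegral.integral_indicator hh]
      refine intervalIntegral.integral_congr fun x _ => ?_
      by_cases hx : x ≤ h
      · simp [Set.indicator, hx]
      · simp [Set.indicator, hx]
    have h2 : sliceMoment (a : ℝ) 0 = ∫ x in (-1 : ℝ)..1, (1 - x ^ 2) ^ (a : ℝ) := by
      simp [sliceMoment]
    rw [hexp, h1, h2, hint, hint, e1, e2]
    simp [div_eq_inv_mul]
  · intro x
    by_cases hx : x ≤ h <;> simp [Set.indicator, hx]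

theorem faceCoef_rat (a s m : ℕ) (hs : 1 ≤ s) : ∃ q : ℚ, (faceCoef a s m).toReal = q := by
  obtain ⟨P, hP⟩ := halfMass_polynomial a
  have ha : (0 : ℝ) ≤ a := by positivity
  have hb0 := sliceExp_nonneg ha hs
  have hb : sliceExp (a : ℝ) s = (((s * (2 * a + 1) - 1) / 2 : ℚ) : ℝ) := by
    simp [sliceExp]
  have hpos := sliceMoment_zero_pos a ha hs
  rw [hb] at hb0 hpos
  obtain ⟨q, hq⟩ := integral_polynomial_sliceWeight_rat (b := (s * (2 * a + 1) - 1) / 2)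
    (by exact_mod_cast hb0) (P ^ m)
  refine ⟨q, ?_⟩
  rw [faceCoef, toReal_sliceMean ((measurable_halfMass _).pow_const m), hb, div_eq_iff hpos.ne', ← hq]
  · refine intervalIntegral.integral_congr fun x hx => ?_
    rw [Set.uIcc_of_le (by norm_num)] at hx
    simp only [ENNReal.toReal_pow, hP x hx, map_pow]
  · intro h
    exact (pow_le_one₀ zero_le (halfMass_le_one _ h)).trans_lt ENNReal.one_lt_top |>.ne

theorem coefRec_rat (a f p : ℕ) : ∃ q : ℚ, coefRec a f p = q := by
  induction p using Nat.strong_induction_on with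
  | _ p ih =>
    choose r hr using fun j : Fin p => ih j j.2
    choose t ht using fun j : Fin p => faceCoef_rat a (f + j + 1) (p - j) (by omega)
    refine ⟨1 - ∑ j : Fin p, (p.choose j : ℚ) * (t j * r j), ?_⟩
    rw [coefRec]
    simp only [hr, ht]
    push_cast
    rfl

end Rationality

section Continuity

open scoped ENNReal Topology
open Filter

variable {a : ℕ → ℝ} {b : ℝ}

theorem tendsto_sliceInt (ha : ∀ n, 0 ≤ a n) (hab : Tendsto a atTop (𝓝 b)) {s : ℕ} (hs : 1 ≤ s)
    {φ : ℕ → ℝ → ℝ≥0∞} {ψ : ℝ → ℝ≥0∞} (hφm : ∀ n, Measurable (φ n)) (hφ1 : ∀ n h, φ n h ≤ 1)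
    (hφ : ∀ h, Tendsto (fun n => φ n h) atTop (𝓝 (ψ h))) :
    Tendsto (fun n => sliceInt (a n) s (φ n)) atTop (𝓝 (sliceInt b s ψ)) := by
  unfold sliceInt
  refine tendsto_lintegral_of_dominated_convergence 1 (fun n => ?_) (fun n => ?_) (by simp) ?_
  · exact (hφm n).mul (by fun_prop)
  · filter_upwards [ae_restrict_mem measurableSet_Ioo] with x hx
    have h1 : 0 < 1 - x ^ 2 := by nlinarith [hx.1, hx.2]
    refine mul_le_one' (hφ1 n x) ?_
    rw [ENNReal.ofReal_le_one]
    exact rpow_le_one h1.le (by nlinarith) (sliceExp_nonneg (ha n) hs)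
  · filter_upwards [ae_restrict_mem measurableSet_Ioo] with x hx
    have h1 : 0 < 1 - x ^ 2 := by nlinarith [hx.1, hx.2]
    have hψ : ψ x ≤ 1 := le_of_tendsto' (hφ x) fun n => hφ1 n x
    refine ENNReal.Tendsto.mul (hφ x) (Or.inr ENNReal.ofReal_ne_top) ?_
      (Or.inr (hψ.trans_lt ENNReal.one_lt_top).ne)
    refine ENNReal.tendsto_ofReal (Tendsto.rpow tendsto_const_nhds ?_ (Or.inl h1.ne'))
    unfold sliceExp
    exact (((hab.const_mul 2).add_const 1).const_mul (s : ℝ) |>.sub_const 1).div_const 2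

theorem tendsto_sliceMean (ha : ∀ n, 0 ≤ a n) (hab : Tendsto a atTop (𝓝 b)) {s : ℕ} (hs : 1 ≤ s)
    {φ : ℕ → ℝ → ℝ≥0∞} {ψ : ℝ → ℝ≥0∞} (hφm : ∀ n, Measurable (φ n)) (hφ1 : ∀ n h, φ n h ≤ 1)
    (hφ : ∀ h, Tendsto (fun n => φ n h) atTop (𝓝 (ψ h))) :
    Tendsto (fun n => sliceMean (a n) s (φ n)) atTop (𝓝 (sliceMean b s ψ)) := by
  have hb : 0 ≤ b := ge_of_tendsto' hab ha
  refine ENNReal.Tendsto.div (tendsto_sliceInt ha hab hs hφm hφ1 hφ)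
    (Or.inr (sliceInt_one_ne_zero b s))
    (tendsto_sliceInt ha hab hs (fun _ => measurable_one) (by simp) fun h => tendsto_const_nhds)
    (Or.inl ?_)
  refine ne_top_of_le_ne_top (sliceInt_one_ne_top hb hs) (lintegral_mono fun x => ?_)
  gcongr

theorem tendsto_faceCoef (ha : ∀ n, 0 ≤ a n) (hab : Tendsto a atTop (𝓝 b)) {s : ℕ} (hs : 1 ≤ s)
    (m : ℕ) : Tendsto (fun n => faceCoef (a n) s m) atTop (𝓝 (faceCoef b s m)) := by
  refine tendsto_sliceMean ha hab hs (fun n => (measurable_halfMass _).pow_const m)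
    (fun n h => pow_le_one' (halfMass_le_one _ h) m) fun h => ENNReal.Tendsto.pow ?_
  exact tendsto_sliceMean ha hab le_rfl (fun _ => measurable_one.indicator measurableSet_Iic)
    (fun _ _ => Set.indicator_le_self' (by simp) _) fun _ => tendsto_const_nhds

theorem tendsto_coefRec (ha : ∀ n, 0 ≤ a n) (hab : Tendsto a atTop (𝓝 b)) (f p : ℕ) :
    Tendsto (fun n => coefRec (a n) f p) atTop (𝓝 (coefRec b f p)) := by
  induction p using Nat.strong_induction_on with
  | _ p ih =>
    have h : ∀ x, coefRec x f p = 1 - ∑ j : Fin p, (p.choose j : ℝ) *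
        ((faceCoef x (f + j + 1) (p - j)).toReal * coefRec x f j) := fun x => by rw [coefRec]
    simp only [h]
    refine tendsto_const_nhds.sub (tendsto_finsetSum _ fun j _ => ?_)
    refine (Tendsto.mul ?_ (ih j j.2)).const_mul _
    exact (ENNReal.tendsto_toReal ((faceCoef_le_one _ _ _).trans_lt ENNReal.one_lt_top).ne).comp
      (tendsto_faceCoef ha hab (by omega) _)

end Continuity

section SphereLimit

open scoped ENNReal Topology Pointwise
open Filter

variable {d : ℕ}

local notation "𝔼" => EuclideanSpace ℝ (Fin d)

theorem volume_inner_eq_mul_norm (hd : 2 ≤ d) {a : 𝔼} {c : ℝ} (hc : 0 < c) :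
    volume {x : 𝔼 | inner ℝ a x = c * ‖x‖} = 0 := by
  have : Nonempty (Fin d) := ⟨⟨0, by omega⟩⟩
  set K : Set 𝔼 := {x | c * ‖x‖ ≤ inner ℝ a x} with hK
  have hconv : Convex ℝ K := by
    intro x hx y hy s t hs ht _
    have hx : c * ‖x‖ ≤ inner ℝ a x := hx
    have hy : c * ‖y‖ ≤ inner ℝ a y := hy
    change c * ‖s • x + t • y‖ ≤ inner ℝ a (s • x + t • y)
    rw [inner_add_right, inner_smul_right, inner_smul_right]
    have h1 := norm_add_le (s • x) (t • y)
    rw [norm_smul, norm_smul, norm_of_nonneg hs, norm_of_nonneg ht] at h1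
    nlinarith [mul_le_mul_of_nonneg_left h1 hc.le, mul_le_mul_of_nonneg_left hx hs,
      mul_le_mul_of_nonneg_left hy ht]
  refine measure_mono_null ?_ (hconv.addHaar_frontier volume)
  intro x hx
  have hx : inner ℝ a x = c * ‖x‖ := hx
  refine ⟨subset_closure hx.ge, fun hint => ?_⟩
  obtain ⟨v, hv0, hv⟩ : ∃ v : 𝔼, v ≠ 0 ∧ inner ℝ a v = 0 := by
    have h := Submodule.finrank_add_finrank_orthogonal (𝕜 := ℝ) (ℝ ∙ a)
    rw [finrank_euclideanSpace_fin] at h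
    have h2 := finrank_span_le_card (R := ℝ) ({a} : Set 𝔼)
    simp only [Set.toFinset_singleton, Finset.card_singleton] at h2
    have : Nontrivial (ℝ ∙ a)ᗮ := Module.nontrivial_of_finrank_pos (R := ℝ) (by omega)
    obtain ⟨⟨v, hv⟩, hv0⟩ := exists_ne (0 : (ℝ ∙ a)ᗮ)
    exact ⟨v, fun h => hv0 (Subtype.ext h), Submodule.mem_orthogonal_singleton_iff_inner_right.1 hv⟩
  obtain ⟨w, hw0, hw, hxw⟩ : ∃ w : 𝔼, w ≠ 0 ∧ inner ℝ a w = 0 ∧ 0 ≤ inner ℝ x w := by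
    rcases le_total 0 (inner ℝ x v) with h | h
    · exact ⟨v, hv0, hv, h⟩
    · exact ⟨-v, neg_ne_zero.2 hv0, by simp [hv], by simpa using h⟩
  have hcont : Tendsto (fun t : ℝ => x + t • w) (𝓝[>] 0) (𝓝 x) := by
    have : Continuous fun t : ℝ => x + t • w := by fun_prop
    simpa using (this.tendsto 0).mono_left nhdsWithin_le_nhds
  have hev := hcont.eventually (mem_interior_iff_mem_nhds.1 hint)
  obtain ⟨t, htK, ht⟩ := (hev.and self_mem_nhdsWithin).exists
  have ht : 0 < t := ht
  have htK : c * ‖x + t • w‖ ≤ inner ℝ a (x + t • w) := htK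
  rw [inner_add_right, inner_smul_right, hw, mul_zero, add_zero, hx, mul_le_mul_iff_right₀ hc] at htK
  have h2 := norm_add_sq_real x (t • w)
  rw [inner_smul_right, norm_smul, mul_pow] at h2
  have h3 : 0 < ‖t‖ ^ 2 * ‖w‖ ^ 2 := by
    have := norm_pos_iff.2 hw0
    have := norm_pos_iff.2 ht.ne'
    positivity
  nlinarith [mul_nonneg ht.le hxw, norm_nonneg x, norm_nonneg (x + t • w)]

theorem sphereUnif_hyperplane (hd : 2 ≤ d) {a : 𝔼} (ha : a ≠ 0) (c : ℝ) :
    sphereUnif d {u | inner ℝ a u.1 = c} = 0 := by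
  have key : ∀ (a : 𝔼) (c : ℝ), 0 < c → sphereUnif d {u | inner ℝ a u.1 = c} = 0 := by
    intro a c hc
    have hm : MeasurableSet {u : Metric.sphere (0 : 𝔼) 1 | inner ℝ a u.1 = c} :=
      measurableSet_eq_fun (by fun_prop) measurable_const
    rw [sphereUnif, Measure.smul_apply, Measure.toSphere_apply' _ hm]
    have : volume (Set.Ioo (0 : ℝ) 1 • (((↑) : Metric.sphere (0 : 𝔼) 1 → 𝔼) ''
        {u | inner ℝ a u.1 = c})) = 0 := by
      refine measure_mono_null ?_ (volume_inner_eq_mul_norm hd (a := a) hc)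
      rintro _ ⟨r, hr, _, ⟨u, hu, rfl⟩, rfl⟩
      have hu : inner ℝ a u.1 = c := hu
      simp only [Set.mem_ofPred_eq, inner_smul_right, hu, norm_smul,
        norm_of_nonneg hr.1.le, norm_eq_of_mem_sphere]
      ring
    simp [this]
  rcases lt_trichotomy c 0 with h | h | h
  · convert key (-a) (-c) (by linarith) using 3
    simp
  · rw [h]
    exact sphereUnif_hyperplane_zero ha
  · exact key a c h

theorem nullOnHyperplanes_betaMeasure_neg_one (hd : 2 ≤ d) :
    NullOnHyperplanes (betaMeasure d (-1)) := by
  intro a c ha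
  rw [betaMeasure, if_pos rfl, Measure.map_apply measurable_subtype_coe
    (measurableSet_eq_fun (by fun_prop) measurable_const)]
  exact sphereUnif_hyperplane hd ha c

theorem lintegral_eq_lintegral_polar (hd : 1 ≤ d) (F : 𝔼 → ℝ≥0∞) :
    ∫⁻ x, F x = ∫⁻ p : Metric.sphere (0 : 𝔼) 1 × Set.Ioi (0 : ℝ), F (p.2.1 • p.1.1)
      ∂((volume : Measure 𝔼).toSphere.prod (Measure.volumeIoiPow (d - 1))) := by
  have : Nonempty (Fin d) := ⟨⟨0, hd⟩⟩
  have hmp := (volume : Measure 𝔼).measurePreserving_homeomorphUnitSphereProd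
  rw [finrank_euclideanSpace_fin] at hmp
  rw [← hmp.lintegral_comp_emb (Homeomorph.measurableEmbedding _)]
  have h1 : ∀ x : ({0}ᶜ : Set 𝔼), F ((homeomorphUnitSphereProd 𝔼 x).2.1 •
      (homeomorphUnitSphereProd 𝔼 x).1.1) = F x.1 := by
    intro x
    have hx : ‖x.1‖ ≠ 0 := norm_ne_zero_iff.2 x.2
    simp [homeomorphUnitSphereProd, smul_smul, hx]
  simp only [h1]
  rw [lintegral_subtype_comap (measurableSet_singleton _).compl, restrict_compl_singleton]

theorem map_normalize_betaMeasure (hd : 1 ≤ d) {β : ℝ} (hβ : -1 < β) :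
    (betaMeasure d β).map (fun x => ‖x‖⁻¹ • x) = betaMeasure d (-1) := by
  have := isProbabilityMeasure_betaMeasure hd hβ
  obtain ⟨C, hC⟩ := betaMeasure_eq_withDensity (d := d) hβ
  have hN : Measurable fun x : 𝔼 => ‖x‖⁻¹ • x := by fun_prop
  set K : ℝ≥0∞ := ∫⁻ r : Set.Ioi (0 : ℝ),
    C * (if r.1 < 1 then ENNReal.ofReal ((1 - r.1 ^ 2) ^ β) else 0)
      ∂(Measure.volumeIoiPow (d - 1)) with hK
  have key : ∀ A : Set 𝔼, MeasurableSet A → (betaMeasure d β).map (fun x => ‖x‖⁻¹ • x) A =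
      (volume : Measure 𝔼).toSphere (Subtype.val ⁻¹' A) * K := by
    intro A hA
    rw [Measure.map_apply hN hA, hC, withDensity_apply _ (hN hA),
      ← lintegral_indicator (hN hA), lintegral_eq_lintegral_polar hd]
    have h1 : ∀ p : Metric.sphere (0 : 𝔼) 1 × Set.Ioi (0 : ℝ),
        ((fun x : 𝔼 => ‖x‖⁻¹ • x) ⁻¹' A).indicator (fun x => C * betaWeight β x)
          (p.2.1 • p.1.1) = (Subtype.val ⁻¹' A).indicator 1 p.1 *
          (C * (if p.2.1 < 1 then ENNReal.ofReal ((1 - p.2.1 ^ 2) ^ β) else 0)) := by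
      rintro ⟨u, r, hr⟩
      have hr : 0 < r := hr
      have h2 : ‖r • u.1‖ = r := by simp [norm_smul, abs_of_pos hr]
      have h3 : ‖r • u.1‖⁻¹ • r • u.1 = u.1 := by
        rw [h2, smul_smul, inv_mul_cancel₀ hr.ne', one_smul]
      have h4 : r • u.1 ∈ (fun x : 𝔼 => ‖x‖⁻¹ • x) ⁻¹' A ↔ u ∈ Subtype.val ⁻¹' A := by
        simp only [Set.mem_preimage, h3]
      by_cases h : u ∈ Subtype.val ⁻¹' A
      · rw [Set.indicator_of_mem (h4.2 h), Set.indicator_of_mem (by exact h)]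
        simp [betaWeight, h2]
      · rw [Set.indicator_of_notMem fun h' => h (h4.1 h'), Set.indicator_of_notMem (by exact h),
          zero_mul]
    simp only [h1]
    rw [lintegral_prod_mul (f := (Subtype.val ⁻¹' A : Set (Metric.sphere (0 : 𝔼) 1)).indicator 1)
      (g := fun r : Set.Ioi (0 : ℝ) =>
        C * (if r.1 < 1 then ENNReal.ofReal ((1 - r.1 ^ 2) ^ β) else 0)),
      lintegral_indicator_one (measurable_subtype_coe hA)]
    · exact (measurable_one.indicator (measurable_subtype_coe hA)).aemeasurable
    · refine (Measurable.const_mul (Measurable.ite ?_ ?_ measurable_const) C).aemeasurable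
      · exact measurableSet_lt measurable_subtype_coe measurable_const
      · fun_prop
  have h1 := key Set.univ MeasurableSet.univ
  rw [Measure.map_apply hN MeasurableSet.univ, Set.preimage_univ, measure_univ,
    Set.preimage_univ] at h1
  have hK' : K = ((volume : Measure 𝔼).toSphere Set.univ)⁻¹ :=
    ENNReal.eq_inv_of_mul_eq_one_left (by rw [mul_comm]; exact h1.symm)
  ext A hA
  rw [key A hA, hK', betaMeasure, if_pos rfl, Measure.map_apply measurable_subtype_coe hA,
    sphereUnif, Measure.smul_apply, smul_eq_mul, mul_comm]

theorem lintegral_edist_normalize (hd : 1 ≤ d) {β : ℝ} (hβ : -1 < β) :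
    ∫⁻ x, edist x (‖x‖⁻¹ • x) ∂(betaMeasure d β) ≤
      ENNReal.ofReal ((β + 1) / ((d : ℝ) / 2 + β + 1)) := by
  have hβ' : -1 < β + 1 := by linarith
  have := isProbabilityMeasure_betaMeasure hd hβ'
  have hd' : (0 : ℝ) < d / 2 := by
    have : (1 : ℝ) ≤ d := by exact_mod_cast hd
    positivity
  have h0 : ∀ β : ℝ, Measurable (betaDensity d β) := fun β =>
    Measurable.const_mul (Measurable.ite (measurableSet_lt (by fun_prop) measurable_const)
      (by fun_prop) measurable_const) _
  have h1 : ∀ x : 𝔼, ENNReal.ofReal (betaDensity d β x) * edist x (‖x‖⁻¹ • x) ≤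
      ENNReal.ofReal ((β + 1) / ((d : ℝ) / 2 + β + 1)) *
        ENNReal.ofReal (betaDensity d (β + 1) x) := by
    intro x
    rw [edist_dist, ← ENNReal.ofReal_mul (betaDensity_nonneg d hβ x),
      ← ENNReal.ofReal_mul (by apply div_nonneg <;> linarith)]
    refine ENNReal.ofReal_le_ofReal ?_
    by_cases hx : ‖x‖ < 1
    · have hdist : dist x (‖x‖⁻¹ • x) ≤ 1 - ‖x‖ ^ 2 := by
        by_cases hx0 : x = 0
        · simp [hx0]
        have hn : 0 < ‖x‖ := norm_pos_iff.2 hx0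
        have : x - ‖x‖⁻¹ • x = (1 - ‖x‖⁻¹) • x := by rw [sub_smul, one_smul]
        have h2 : 1 ≤ ‖x‖⁻¹ := (one_le_inv₀ hn).2 hx.le
        rw [dist_eq_norm, this, norm_smul, norm_of_nonpos (by linarith), neg_sub, sub_mul,
          inv_mul_cancel₀ hn.ne']
        nlinarith
      have h2 : betaDensity d β x * (1 - ‖x‖ ^ 2) =
          (β + 1) / ((d : ℝ) / 2 + β + 1) * betaDensity d (β + 1) x := by
        have hpos : 0 < 1 - ‖x‖ ^ 2 := by nlinarith [norm_nonneg x]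
        rw [betaDensity, betaDensity, if_pos hx, if_pos hx, rpow_add_one hpos.ne',
          show (d : ℝ) / 2 + (β + 1) + 1 = ((d : ℝ) / 2 + β + 1) + 1 by ring,
          Gamma_add_one (s := (d : ℝ) / 2 + β + 1) (by linarith),
          Gamma_add_one (s := β + 1) (by linarith)]
        have h3 : (d : ℝ) / 2 + β + 1 ≠ 0 := by linarith
        have h4 : β + 1 ≠ 0 := by linarith
        have h5 := (Gamma_pos_of_pos (by linarith : 0 < β + 1)).ne'
        generalize Gamma ((d : ℝ) / 2 + β + 1) = G
        generalize (d : ℝ) / 2 + β + 1 = g at *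
        field_simp
      rw [← h2]
      exact mul_le_mul_of_nonneg_left hdist (betaDensity_nonneg d hβ x)
    · simp [betaDensity, hx]
  have hm : Measurable fun x : 𝔼 => edist x (‖x‖⁻¹ • x) := by fun_prop
  have h2 : ∫⁻ x, ENNReal.ofReal (betaDensity d (β + 1) x) = 1 := by
    have := measure_univ (μ := betaMeasure d (β + 1))
    rwa [betaMeasure, if_neg hβ'.ne', withDensity_apply _ MeasurableSet.univ,
      Measure.restrict_univ] at this
  rw [betaMeasure, if_neg hβ.ne', lintegral_withDensity_eq_lintegral_mul _ (h0 β).ennreal_ofReal hm]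
  refine (lintegral_mono h1).trans_eq ?_
  rw [lintegral_const_mul _ (h0 _).ennreal_ofReal, h2, mul_one]

end SphereLimit

section SphereLimit

open scoped ENNReal Topology NNReal
open Filter

theorem tendsto_measure_of_coupling {Ω : Type*} [PseudoEMetricSpace Ω] [MeasurableSpace Ω]
    [BorelSpace Ω] {m : ℕ → Measure Ω} {ν : Measure Ω} [hm : ∀ n, IsProbabilityMeasure (m n)]
    [IsProbabilityMeasure ν] {T : Ω → Ω} (hT : Measurable T) (hmap : ∀ n, (m n).map T = ν)
    (hlim : Tendsto (fun n => ∫⁻ x, edist x (T x) ∂(m n)) atTop (𝓝 0)) {S : Set Ω}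
    (hS : ν (frontier S) = 0) : Tendsto (fun n => m n S) atTop (𝓝 (ν S)) := by
  set M : ℕ → ProbabilityMeasure Ω := fun n => ⟨m n, hm n⟩
  set N : ProbabilityMeasure Ω := ⟨ν, inferInstance⟩
  have key : Tendsto M atTop (𝓝 N) := by
    rw [tendsto_iff_forall_lipschitz_integral_tendsto]
    rintro f ⟨C, hC⟩ ⟨L, hL⟩
    have hfm : Measurable f := hL.continuous.measurable
    have hint : ∀ (μ : Measure Ω) [IsProbabilityMeasure μ], Integrable f μ := by
      intro μ _
      obtain ⟨x₀⟩ := μ.nonempty_of_neZero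
      refine Integrable.of_bound hfm.aestronglyMeasurable (‖f x₀‖ + C)
        (Eventually.of_forall fun x => ?_)
      have := hC x x₀
      rw [dist_eq_norm] at this
      linarith [norm_le_norm_add_norm_sub' (f x) (f x₀)]
    change Tendsto (fun n => ∫ x, f x ∂(m n)) atTop (𝓝 (∫ x, f x ∂ν))
    have h0 : Tendsto (fun n => L * ∫⁻ x, edist x (T x) ∂(m n)) atTop (𝓝 0) := by
      simpa using ENNReal.Tendsto.const_mul hlim (Or.inr (ENNReal.coe_ne_top (r := L)))
    rw [tendsto_iff_edist_tendsto_0]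
    refine tendsto_of_tendsto_of_tendsto_of_le_of_le tendsto_const_nhds h0 (fun _ => zero_le)
      fun n => ?_
    have h1 : ∫ x, f x ∂ν = ∫ x, f (T x) ∂(m n) := by
      rw [← hmap n, integral_map hT.aemeasurable hfm.aestronglyMeasurable]
    have hintT : Integrable (fun x => f (T x)) (m n) := by
      have := hint ν
      rw [← hmap n] at this
      exact this.comp_measurable hT
    change edist (∫ x, f x ∂(m n)) (∫ x, f x ∂ν) ≤ L * ∫⁻ x, edist x (T x) ∂(m n)
    rw [h1, edist_eq_enorm_sub, ← integral_sub (hint _) hintT]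
    refine (enorm_integral_le_lintegral_enorm _).trans ?_
    rw [← lintegral_const_mul' _ _ ENNReal.coe_ne_top]
    refine lintegral_mono fun x => ?_
    rw [← edist_eq_enorm_sub]
    exact hL x (T x)
  exact ProbabilityMeasure.tendsto_measure_of_null_frontier_of_tendsto' key hS

variable {d : ℕ}

local notation "𝔼" => EuclideanSpace ℝ (Fin d)

theorem continuousAt_projCoef {E : Type*} [NormedAddCommGroup E] [InnerProductSpace ℝ E]
    {ι : Type*} [Fintype ι] {p : (ι → E) × E} (hp : LinearIndependent ℝ p.1) (i : ι) :
    ContinuousAt (fun p : (ι → E) × E => projCoef p.1 p.2 i) p := by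
  classical
  simp only [projCoef_eq_inv_det]
  refine ContinuousAt.mul (ContinuousAt.inv₀ ?_ ?_)
    (continuous_adjugate_gram_mulVec i).continuousAt
  · exact (continuous_det_gram.comp continuous_fst).continuousAt
  · exact (Matrix.posDef_gram_of_linearIndependent hp).det_pos.ne'

theorem frontier_edgeSet_subset (Q : Finset (Fin d)) :
    frontier (edgeSet Q) ⊆ {p : (Fin (d + 1) → 𝔼) × Metric.sphere (0 : 𝔼) 1 |
      LinearIndependent ℝ (fun i : Fin d => p.1 i.succ - p.1 0) →
      ∃ i, projCoef (fun i : Fin d => p.1 i.succ - p.1 0) p.2.1 i = 0} := by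
  intro p hp hli
  by_contra! hne
  have hc : ∀ i, ContinuousAt (fun p : (Fin (d + 1) → 𝔼) × Metric.sphere (0 : 𝔼) 1 =>
      projCoef (fun i : Fin d => p.1 i.succ - p.1 0) p.2.1 i) p := by
    intro i
    have h1 : Continuous fun p : (Fin (d + 1) → 𝔼) × Metric.sphere (0 : 𝔼) 1 =>
        ((fun i : Fin d => p.1 i.succ - p.1 0, p.2.1) : (Fin d → 𝔼) × 𝔼) := by fun_prop
    have h2 := ContinuousAt.comp (g := fun q : (Fin d → 𝔼) × 𝔼 => projCoef q.1 q.2 i) (x := p)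
      (f := fun p : (Fin (d + 1) → 𝔼) × Metric.sphere (0 : 𝔼) 1 =>
        ((fun i : Fin d => p.1 i.succ - p.1 0, p.2.1) : (Fin d → 𝔼) × 𝔼))
      (continuousAt_projCoef (p := (fun i : Fin d => p.1 i.succ - p.1 0, p.2.1)) hli i)
      h1.continuousAt
    simp only [Function.comp_def] at h2
    exact h2
  rw [frontier, Set.mem_sdiff, mem_interior_iff_mem_nhds, mem_closure_iff_frequently] at hp
  by_cases h : ∀ i ∈ Q, 0 < projCoef (fun i : Fin d => p.1 i.succ - p.1 0) p.2.1 i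
  · refine hp.2 ?_
    have : ∀ᶠ q in 𝓝 p, ∀ i ∈ Q, 0 < projCoef (fun i : Fin d => q.1 i.succ - q.1 0) q.2.1 i :=
      (Finset.eventually_all Q).2 fun i hi => (hc i).eventually (lt_mem_nhds (h i hi))
    exact this
  · push Not at h
    obtain ⟨i, hi, h⟩ := h
    have := (hc i).eventually (gt_mem_nhds (lt_of_le_of_ne h (hne i)))
    exact hp.1 (this.mono fun q hq hq' => lt_asymm hq (hq' i hi))

theorem measure_frontier_edgeSet (hd : 1 ≤ d) {μ : Measure 𝔼} [IsProbabilityMeasure μ]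
    (hμ : NullOnHyperplanes μ) (Q : Finset (Fin d)) :
    ((Measure.pi fun _ : Fin (d + 1) => μ).prod (sphereUnif d)) (frontier (edgeSet Q)) = 0 := by
  have := isProbabilityMeasure_sphereUnif hd
  rw [Measure.measure_prod_null isClosed_frontier.measurableSet]
  filter_upwards [ae_linearIndependent_edges hμ] with X hX
  refine measure_mono_null (fun u hu => frontier_edgeSet_subset Q hu hX) ?_
  have : {u : Metric.sphere (0 : 𝔼) 1 | ∃ i, projCoef (fun i : Fin d => X i.succ - X 0) u.1 i = 0} =
      ⋃ i, {u | projCoef (fun i : Fin d => X i.succ - X 0) u.1 i = 0} := by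
    ext u
    simp
  refine (congrArg (sphereUnif d) this).trans_le ?_ |>.antisymm zero_le
  refine (measure_iUnion_null fun i => ?_).le
  obtain ⟨a, ha, h⟩ := exists_projCoef_eq_inner hX i
  simp only [h]
  exact sphereUnif_hyperplane_zero ha

theorem lintegral_edist_normalize_prod (hd : 1 ≤ d) {β : ℝ} (hβ : -1 < β) :
    ∫⁻ p : (Fin (d + 1) → 𝔼) × Metric.sphere (0 : 𝔼) 1,
      edist p (Prod.map (fun X i => ‖X i‖⁻¹ • X i) id p)
      ∂((Measure.pi fun _ : Fin (d + 1) => betaMeasure d β).prod (sphereUnif d)) ≤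
    (d + 1) * ENNReal.ofReal ((β + 1) / ((d : ℝ) / 2 + β + 1)) := by
  have := isProbabilityMeasure_sphereUnif hd
  have := isProbabilityMeasure_betaMeasure hd hβ
  have hN : Measurable fun x : 𝔼 => edist x (‖x‖⁻¹ • x) := by fun_prop
  have h1 : ∀ p : (Fin (d + 1) → 𝔼) × Metric.sphere (0 : 𝔼) 1,
      edist p (Prod.map (fun X i => ‖X i‖⁻¹ • X i) id p) ≤
      ∑ i, edist (p.1 i) (‖p.1 i‖⁻¹ • p.1 i) := by
    intro p
    rw [Prod.edist_eq, Prod.map_fst, Prod.map_snd, id, edist_self, max_eq_left zero_le,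
      edist_pi_def]
    exact Finset.sup_le fun i hi =>
      Finset.single_le_sum (f := fun i => edist (p.1 i) (‖p.1 i‖⁻¹ • p.1 i))
        (fun _ _ => zero_le) hi
  refine (lintegral_mono h1).trans ?_
  have h2 : ∀ i, Measurable fun p : (Fin (d + 1) → 𝔼) × Metric.sphere (0 : 𝔼) 1 =>
      edist (p.1 i) (‖p.1 i‖⁻¹ • p.1 i) := fun i =>
    hN.comp ((measurable_pi_apply i).comp measurable_fst)
  rw [lintegral_finsetSum _ fun i _ => h2 i]
  have h3 : ∀ i, ∫⁻ p : (Fin (d + 1) → 𝔼) × Metric.sphere (0 : 𝔼) 1,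
      edist (p.1 i) (‖p.1 i‖⁻¹ • p.1 i)
      ∂((Measure.pi fun _ : Fin (d + 1) => betaMeasure d β).prod (sphereUnif d)) =
      ∫⁻ x, edist x (‖x‖⁻¹ • x) ∂(betaMeasure d β) := by
    intro i
    rw [lintegral_prod _ (h2 i).aemeasurable]
    simp only [lintegral_const, measure_univ, mul_one]
    exact (measurePreserving_eval (fun _ : Fin (d + 1) => betaMeasure d β) i).lintegral_comp hN
  simp only [h3, Finset.sum_const, Finset.card_univ, Fintype.card_fin, nsmul_eq_mul]
  push_cast
  gcongr
  exact lintegral_edist_normalize hd hβ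

/-- The expected internal angle for `β = -1`. -/
theorem J_neg_one_eq_coefRec (hd : 3 ≤ d) {k : ℕ} (hk : 1 ≤ k) (hkd : k ≤ d + 1) :
    J (d + 1) k (-1) = coefRec (-1 + ((d : ℝ) - 1) / 2) (k - 1) (d + 1 - k) := by
  have hd1 : 1 ≤ d := by omega
  have hd3 : (3 : ℝ) ≤ d := by exact_mod_cast hd
  have := isProbabilityMeasure_sphereUnif hd1
  have := isProbabilityMeasure_betaMeasure_neg_one hd1
  have hnull := nullOnHyperplanes_betaMeasure_neg_one (d := d) (by omega)
  set b : ℕ → ℝ := fun n => -1 + 1 / ((n : ℝ) + 1) with hb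
  have hb1 : ∀ n, -1 < b n := fun n => by
    have : 0 < 1 / ((n : ℝ) + 1) := by positivity
    simp only [hb]
    linarith
  have hblim : Tendsto b atTop (𝓝 (-1)) := by
    simpa [hb] using tendsto_one_div_add_atTop_nhds_zero_nat.const_add (-1 : ℝ)
  have := fun n => isProbabilityMeasure_betaMeasure hd1 (hb1 n)
  have hN : Measurable fun x : 𝔼 => ‖x‖⁻¹ • x := by fun_prop
  have hNpi : Measurable fun (X : Fin (d + 1) → 𝔼) i => ‖X i‖⁻¹ • X i :=
    measurable_pi_lambda _ fun i => hN.comp (measurable_pi_apply i)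
  have h1 := tendsto_measure_of_coupling
    (m := fun n => (Measure.pi fun _ : Fin (d + 1) => betaMeasure d (b n)).prod (sphereUnif d))
    (ν := (Measure.pi fun _ : Fin (d + 1) => betaMeasure d (-1)).prod (sphereUnif d))
    (T := Prod.map (fun X i => ‖X i‖⁻¹ • X i) id) (hNpi.prodMap measurable_id)
    (fun n => by
      rw [← Measure.map_prod_map _ _ hNpi measurable_id, Measure.map_id]
      rw [Measure.pi_map_pi fun _ => hN.aemeasurable]
      simp only [map_normalize_betaMeasure hd1 (hb1 n)])
    (by
      have h0 : Tendsto (fun n => ((d : ℝ≥0∞) + 1) *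
          ENNReal.ofReal ((b n + 1) / ((d : ℝ) / 2 + b n + 1))) atTop (𝓝 0) := by
        have h2 : Tendsto (fun n => (b n + 1) / ((d : ℝ) / 2 + b n + 1)) atTop (𝓝 0) := by
          have := (hblim.add_const 1).div ((hblim.const_add ((d : ℝ) / 2)).add_const 1)
            (by linarith : (d : ℝ) / 2 + -1 + 1 ≠ 0)
          rw [neg_add_cancel, zero_div] at this
          exact this
        have h3 := ENNReal.tendsto_ofReal h2
        rw [ENNReal.ofReal_zero] at h3
        have h4 := ENNReal.Tendsto.const_mul (a := (d : ℝ≥0∞) + 1) h3 (Or.inr (by simp))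
        rwa [mul_zero] at h4
      exact tendsto_of_tendsto_of_tendsto_of_le_of_le tendsto_const_nhds h0 (fun _ => zero_le)
        fun n => lintegral_edist_normalize_prod hd1 (hb1 n))
    (measure_frontier_edgeSet hd1 hnull (coneCoords d k))
  have h2 := (ENNReal.tendsto_toReal (measure_ne_top _ _)).comp h1
  have ha : ∀ n, 0 ≤ b n + ((d : ℝ) - 1) / 2 := fun n => by linarith [hb1 n]
  have h3 := tendsto_coefRec (a := fun n => b n + ((d : ℝ) - 1) / 2) ha
    (hblim.add_const _) (k - 1) (d + 1 - k)
  have h4 := tendsto_nhds_unique (h2.congr fun n =>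
    measure_edgeSet_betaMeasure hd1 (hb1 n) (ha n) hk hkd) h3
  rw [← h4]
  exact integral_internalAngle hd1 hnull hk hkd

end SphereLimit

section DimensionOne

open scoped ENNReal Pointwise

local notation "𝕊" => Metric.sphere (0 : EuclideanSpace ℝ (Fin 1)) 1

theorem eq_or_eq_neg_of_mem_sphere_one (u v : 𝕊) : v = u ∨ v = -u := by
  have h : ∀ u : 𝕊, u.1 0 ^ 2 = 1 := by
    intro u
    have := EuclideanSpace.norm_sq_eq u.1
    simp only [norm_eq_of_mem_sphere, Fin.sum_univ_one, norm_eq_abs, sq_abs] at this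
    linarith
  have h1 : ∀ x y : EuclideanSpace ℝ (Fin 1), x 0 = y 0 → x = y := fun x y h => by
    ext i
    rwa [Subsingleton.elim i 0]
  rcases sq_eq_sq_iff_eq_or_eq_neg.1 ((h v).trans (h u).symm) with h2 | h2
  · exact Or.inl (Subtype.ext (h1 _ _ h2))
  · exact Or.inr (Subtype.ext (h1 _ _ (by simpa using h2)))

instance finite_sphere_one : Finite 𝕊 := by
  obtain h | ⟨⟨u⟩⟩ := isEmpty_or_nonempty 𝕊
  · infer_instance
  · exact Set.finite_univ_iff.1 ((Set.toFinite {u, -u}).subset fun v _ =>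
      eq_or_eq_neg_of_mem_sphere_one u v)

theorem sphereUnif_one_singleton_neg (u : 𝕊) : sphereUnif 1 {-u} = sphereUnif 1 {u} := by
  rw [sphereUnif, Measure.smul_apply, Measure.smul_apply,
    Measure.toSphere_apply' _ (measurableSet_singleton _),
    Measure.toSphere_apply' _ (measurableSet_singleton _), Set.image_singleton, Set.image_singleton]
  have : Set.Ioo (0 : ℝ) 1 • ({(-u).1} : Set (EuclideanSpace ℝ (Fin 1))) =
      -(Set.Ioo (0 : ℝ) 1 • {u.1}) := by
    simp [← Set.image_neg_eq_neg, Set.image_image]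
  rw [this, Measure.measure_neg]

theorem sphereUnif_one_rat (S : Set 𝕊) : ∃ q : ℚ, (sphereUnif 1).real S = q := by
  classical
  have := isProbabilityMeasure_sphereUnif (d := 1) le_rfl
  have := Fintype.ofFinite 𝕊
  obtain ⟨u⟩ : Nonempty 𝕊 := (sphereUnif 1).nonempty_of_neZero
  have h1 : ∀ v, (sphereUnif 1).real {v} = (sphereUnif 1).real {u} := by
    intro v
    rcases eq_or_eq_neg_of_mem_sphere_one u v with rfl | rfl
    · rfl
    · rw [measureReal_def, sphereUnif_one_singleton_neg, measureReal_def]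
  have h2 : ∀ T : Finset 𝕊, (sphereUnif 1).real T = T.card * (sphereUnif 1).real {u} := by
    intro T
    rw [← sum_measureReal_singleton]
    simp [h1]
  have h3 := h2 Finset.univ
  rw [Finset.coe_univ, probReal_univ] at h3
  refine ⟨S.toFinset.card / (Finset.univ : Finset 𝕊).card, ?_⟩
  have h4 := h2 S.toFinset
  rw [Set.coe_toFinset] at h4
  have h5 : ((Finset.univ : Finset 𝕊).card : ℝ) ≠ 0 := by
    intro h
    rw [h, zero_mul] at h3
    exact one_ne_zero h3
  rw [h4, eq_div_of_mul_eq h5 ((mul_comm _ _).trans h3.symm)]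
  push_cast
  ring

theorem J_two_neg_one_rat (k : ℕ) : ∃ q : ℚ, J 2 k (-1) = q := by
  classical
  have := isProbabilityMeasure_sphereUnif (d := 1) le_rfl
  have := isProbabilityMeasure_betaMeasure_neg_one (d := 1) le_rfl
  have := Fintype.ofFinite (Fin 2 → 𝕊)
  set g : (Fin 2 → EuclideanSpace ℝ (Fin 1)) → ℝ := fun X => internalAngle
    ((k : ℝ)⁻¹ • ∑ i ∈ Finset.univ.filter (fun i : Fin 2 => (i : ℕ) < k), X i)
    (convexHull ℝ (Set.range X)) with hg
  have hgq : ∀ X, ∃ q : ℚ, g X = q := fun X => sphereUnif_one_rat _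
  have hemb : MeasurableEmbedding fun (U : Fin 2 → 𝕊) i => (U i).1 :=
    (Continuous.isClosedEmbedding (by fun_prop) fun U V h =>
      funext fun i => Subtype.ext (congrFun h i)).measurableEmbedding
  have hmap : (Measure.pi fun _ : Fin 2 => betaMeasure 1 (-1)) =
      (Measure.pi fun _ : Fin 2 => sphereUnif 1).map fun U i => (U i).1 := by
    have : IsProbabilityMeasure ((sphereUnif 1).map (Subtype.val : 𝕊 → _)) :=
      Measure.isProbabilityMeasure_map measurable_subtype_coe.aemeasurable
    rw [Measure.pi_map_pi fun _ => measurable_subtype_coe.aemeasurable, betaMeasure, if_pos rfl]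
  have h1 : J 2 k (-1) = ∑ U : Fin 2 → 𝕊, (∏ i, (sphereUnif 1).real {U i}) * g fun i => (U i).1 := by
    change ∫ X, g X ∂(Measure.pi fun _ : Fin 2 => betaMeasure 1 (-1)) = _
    rw [hmap, hemb.integral_map, integral_fintype Integrable.of_finite]
    refine Finset.sum_congr rfl fun U _ => ?_
    rw [smul_eq_mul, measureReal_def, Measure.pi_singleton, ENNReal.toReal_prod]
    rfl
  choose r hr using hgq
  choose t ht using fun u : 𝕊 => sphereUnif_one_rat {u}
  refine ⟨∑ U : Fin 2 → 𝕊, (∏ i, t (U i)) * r fun i => (U i).1, ?_⟩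
  rw [h1]
  push_cast
  simp only [ht, hr]

end DimensionOne

theorem J_one_eq_zero (k : ℕ) (β : ℝ) : J 1 k β = 0 := by
  have : IsEmpty (Metric.sphere (0 : EuclideanSpace ℝ (Fin (1 - 1))) 1) :=
    ⟨fun u => ne_zero_of_mem_unit_sphere u (Subsingleton.elim (α := EuclideanSpace ℝ (Fin 0)) _ _)⟩
  have h : ∀ (g : EuclideanSpace ℝ (Fin (1 - 1))) P, internalAngle g P = 0 := fun g P => by
    rw [internalAngle, Set.eq_empty_of_isEmpty {u | _}, measure_empty, ENNReal.toReal_zero]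
  simp only [J, h, integral_zero]

theorem J_rational (β : ℝ) (hβ : -1 ≤ β) (hhalf : ∃ m : ℤ, 2 * β = (m : ℝ))
    (n k : ℕ) (hk1 : 1 ≤ k) (hk2 : k ≤ n)
    (heven : ∃ m : ℤ, 2 * β + n = 2 * (m : ℝ)) : ∃ q : ℚ, J n k β = (q : ℝ) := by
  obtain ⟨d, rfl⟩ : ∃ d, n = d + 1 := ⟨n - 1, by omega⟩
  obtain ⟨m, hm⟩ := heven
  push_cast at hm
  rcases Nat.eq_zero_or_pos d with rfl | hd
  · exact ⟨0, by rw [J_one_eq_zero, Rat.cast_zero]⟩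
  have hd' : (1 : ℝ) ≤ d := by exact_mod_cast hd
  by_cases h1 : d = 1 ∧ β = -1
  · rw [h1.1, h1.2]
    exact J_two_neg_one_rat k
  have ha : β + ((d : ℝ) - 1) / 2 = ((m - 1 : ℤ) : ℝ) := by
    push_cast
    linarith
  have hm1 : 0 ≤ m - 1 := by
    obtain ⟨l, hl⟩ := hhalf
    have h2 : l + d + 1 = 2 * m := by
      have : ((l + d + 1 : ℤ) : ℝ) = ((2 * m : ℤ) : ℝ) := by
        push_cast
        linarith
      exact_mod_cast this
    have h3 : -2 ≤ l := by
      have : ((-2 : ℤ) : ℝ) ≤ l := by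
        push_cast
        linarith
      exact_mod_cast this
    have h4 : ¬(d = 1 ∧ l = -2) := fun h => h1 ⟨h.1, by
      rw [h.2] at hl
      push_cast at hl
      linarith⟩
    omega
  obtain ⟨a, ha'⟩ := Int.eq_ofNat_of_zero_le hm1
  rw [ha'] at ha
  push_cast at ha
  rcases hβ.eq_or_lt with rfl | hβ
  · have hd3 : 3 ≤ d := by
      have h2 : d = 2 * a + 3 := by
        have : (d : ℝ) = ((2 * a + 3 : ℕ) : ℝ) := by
          push_cast
          linarith
        exact_mod_cast this
      omega
    rw [J_neg_one_eq_coefRec hd3 hk1 hk2, ha]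
    exact coefRec_rat _ _ _
  · rw [J_eq_coefRec hd hβ (by rw [ha]; positivity) hk1 hk2, ha]
    exact coefRec_rat _ _ _

theorem Jb_rational (β : ℝ) (hβ : -1 ≤ β) (hhalf : ∃ m : ℤ, 2 * β = (m : ℝ))
    (n k : ℕ) (hk1 : 1 ≤ k) (hk2 : k ≤ n)
    (heven : ∃ m : ℤ, 2 * β + n = 2 * (m : ℝ)) :
    ∃ q : ℚ, Jb n k β = (q : ℝ) := by
  obtain ⟨q, hq⟩ := J_rational β hβ hhalf n k hk1 hk2 heven
  exact ⟨n.choose k * q, by rw [Jb, hq]; push_cast; rfl⟩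

end
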